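/- For R > 0, δ > 0, and Λ > 1, let U_{R,δ,Λ} denote the set of V ∈ LP such that Leb(σ(H_{λV}) ∩ [-R,R]) < δ for all λ with Λ^{-1} ≤ λ ≤ Λ. Then for all R, δ > 0 and Λ > 1, the set U_{R,δ,Λ} is a dense open subset of LP. -/

import Mathlib

open MeasureTheory Filter Set BoundedContinuousFunction
open scoped ENNReal

noncomputable section
/-- The spectrum of the Schrödinger operator `H_V φ = -φ'' + Vφ` on `L²(ℝ)`, characterized
via Weyl sequences drawn from the core `C_c²(ℝ)` of the (essentially self-adjoint) operator:
`E ∈ σ(H_V)` iff there are compactly supported `C²` functions `u` of unit `L²` norm with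
`‖(H_V - E)u‖_{L²}` arbitrarily small. -/
def schrodingerSpectrum (V : ℝ → ℝ) : Set ℝ :=
  {E : ℝ | ∀ ε : ℝ, 0 < ε → ∃ u : ℝ → ℂ,
    ContDiff ℝ 2 u ∧ HasCompactSupport u ∧
    (∫ x : ℝ, ‖u x‖ ^ 2) = 1 ∧
    (∫ x : ℝ, ‖-deriv (deriv u) x + (V x : ℂ) * u x - (E : ℂ) * u x‖ ^ 2) < ε}
/-- The space of (uniformly) limit-periodic functions on `ℝ`: uniform limits of continuous
periodic functions, viewed inside the bounded continuous functions with the sup norm. -/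
def LP : Set (ℝ →ᵇ ℝ) :=
  closure {f : ℝ →ᵇ ℝ | ∃ T : ℝ, 0 < T ∧ Function.Periodic (⇑f) T}

/-- The set `U_{R,δ,Λ}` of limit-periodic potentials `V` with
`Leb(σ(H_{λV}) ∩ [-R,R]) < δ` for all `Λ⁻¹ ≤ λ ≤ Λ`. -/
def Uset (R δ Λ : ℝ) : Set ↥LP :=
  {V : ↥LP | ∀ lam : ℝ, lam ∈ Set.Icc Λ⁻¹ Λ →
    volume (schrodingerSpectrum (fun x => lam * (V : ℝ →ᵇ ℝ) x) ∩ Set.Icc (-R) R)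
      < ENNReal.ofReal δ}

open scoped Topology


/-- lower bound for the Schrödinger operator with potential `q` on functions living in `s` -/
def Res (s : Set ℝ) (q : ℝ → ℝ) (c : ℝ) : Prop :=
  ∀ u : ℝ → ℝ, ContDiff ℝ 2 u → HasCompactSupport u → (∀ x, x ∉ s → u x = 0) →
    c * ∫ x, u x ^ 2 ≤ ∫ x, (-deriv (deriv u) x + q x * u x) ^ 2

lemma c2_diff {u : ℝ → ℝ} (hu : ContDiff ℝ 2 u) : Differentiable ℝ u :=
  hu.differentiable (by norm_num)

lemma c2_deriv {u : ℝ → ℝ} (hu : ContDiff ℝ 2 u) : ContDiff ℝ 1 (deriv u) := by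
  have : ContDiff ℝ (1 + 1) u := by simpa [one_add_one_eq_two] using hu
  exact ((contDiff_succ_iff_deriv (n := 1)).1 this).2.2

lemma c2_diff' {u : ℝ → ℝ} (hu : ContDiff ℝ 2 u) : Differentiable ℝ (deriv u) :=
  (c2_deriv hu).differentiable (by norm_num)

lemma c2_cont {u : ℝ → ℝ} (hu : ContDiff ℝ 2 u) : Continuous u := hu.continuous

lemma c2_cont' {u : ℝ → ℝ} (hu : ContDiff ℝ 2 u) : Continuous (deriv u) := (c2_deriv hu).continuous

lemma c2_cont'' {u : ℝ → ℝ} (hu : ContDiff ℝ 2 u) : Continuous (deriv (deriv u)) :=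
  (c2_deriv hu).continuous_deriv (by norm_num)

lemma int_cs {f : ℝ → ℝ} (hf : Continuous f) (h : HasCompactSupport f) : Integrable f :=
  hf.integrable_of_hasCompactSupport h

lemma cs_op {u q : ℝ → ℝ} (h : HasCompactSupport u) :
    HasCompactSupport (fun x => -deriv (deriv u) x + q x * u x) := by
  have h1 : HasCompactSupport (fun x => -deriv (deriv u) x) := h.deriv.deriv.neg
  have h2 : HasCompactSupport (fun x => q x * u x) := HasCompactSupport.mul_left h
  exact h1.add h2

lemma cs_sq {f : ℝ → ℝ} (h : HasCompactSupport f) : HasCompactSupport (fun x => f x ^ 2) :=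
  h.comp_left (g := fun y : ℝ => y ^ 2) (by norm_num)

lemma int_sq {f : ℝ → ℝ} (hf : Continuous f) (h : HasCompactSupport f) :
    Integrable (fun x => f x ^ 2) :=
  int_cs (hf.pow 2) (cs_sq h)

lemma int_op {u q : ℝ → ℝ} (hq : Continuous q) (hu : ContDiff ℝ 2 u) (h : HasCompactSupport u) :
    Integrable (fun x => (-deriv (deriv u) x + q x * u x) ^ 2) := by
  refine int_sq ?_ (cs_op h)
  have := c2_cont'' hu
  have := c2_cont hu
  fun_prop

lemma Res.mono {s t : Set ℝ} {q : ℝ → ℝ} {c : ℝ} (h : Res s q c) (hst : t ⊆ s) : Res t q c :=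
  fun u h1 h2 h3 => h u h1 h2 fun x hx => h3 x fun hxt => hx (hst hxt)

lemma Res.mono_c {s : Set ℝ} {q : ℝ → ℝ} {c c' : ℝ} (h : Res s q c) (hc : c' ≤ c) :
    Res s q c' := by
  intro u h1 h2 h3
  refine le_trans ?_ (h u h1 h2 h3)
  exact mul_le_mul_of_nonneg_right hc (integral_nonneg fun x => sq_nonneg _)

lemma Res.perturb {s : Set ℝ} {q q' : ℝ → ℝ} {c a : ℝ} (h : Res s q c) (hq : Continuous q)
    (hq' : Continuous q') (ha : ∀ x, |q x - q' x| ≤ a) (hac : a ^ 2 ≤ c / 4) :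
    Res s q' (c / 4) := by
  intro u h1 h2 h3
  have h4 := h u h1 h2 h3
  have h5 : ∫ x, (-deriv (deriv u) x + q x * u x) ^ 2 ≤
      ∫ x, (2 * (-deriv (deriv u) x + q' x * u x) ^ 2 + c / 2 * u x ^ 2) := by
    refine integral_mono (int_op hq h1 h2) ?_ ?_
    · exact ((int_op hq' h1 h2).const_mul 2).add ((int_sq (c2_cont h1) h2).const_mul _)
    · intro x
      have e1 : (q x - q' x) ^ 2 ≤ c / 4 := by
        have := sq_le_sq' (by linarith [abs_nonneg (q x - q' x), ha x, neg_abs_le (q x - q' x)])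
          ((le_abs_self _).trans (ha x))
        linarith
      have e2 : (q x - q' x) ^ 2 * u x ^ 2 ≤ c / 4 * u x ^ 2 :=
        mul_le_mul_of_nonneg_right e1 (sq_nonneg _)
      simp only
      nlinarith [sq_nonneg ((-deriv (deriv u) x + q' x * u x) - (q x - q' x) * u x)]
  rw [integral_add ((int_op hq' h1 h2).const_mul 2) ((int_sq (c2_cont h1) h2).const_mul _),
    integral_const_mul, integral_const_mul] at h5
  linarith

/-- translation -/
lemma Res.translate {s : Set ℝ} {q q' : ℝ → ℝ} {c d : ℝ} (h : Res s q c) {t : Set ℝ}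
    (hts : ∀ x, x + d ∈ t → x ∈ s) (hq : ∀ x, x ∈ s → q' (x + d) = q x) : Res t q' c := by
  intro u h1 h2 h3
  have hd : deriv (deriv fun x => u (x + d)) = fun x => deriv (deriv u) (x + d) := by
    have : (deriv fun x => u (x + d)) = fun x => deriv u (x + d) := by
      funext x; exact deriv_comp_add_const u d x
    rw [this]; funext x; exact deriv_comp_add_const (deriv u) d x
  have hz : ∀ x, x ∉ s → u (x + d) = 0 := fun x hx => h3 _ fun hxt => hx (hts x hxt)
  have h4 := h (fun x => u (x + d)) (h1.comp (contDiff_id.add contDiff_const))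
    (h2.comp_homeomorph (Homeomorph.addRight d)) hz
  rw [hd] at h4
  have e1 : ∫ x, (u (x + d)) ^ 2 = ∫ x, u x ^ 2 :=
    integral_add_right_eq_self (μ := volume) (fun x => u x ^ 2) d
  have e2 : ∫ x, (-deriv (deriv u) (x + d) + q x * u (x + d)) ^ 2
      = ∫ x, (-deriv (deriv u) x + q' x * u x) ^ 2 := by
    rw [← integral_add_right_eq_self (μ := volume)
      (fun x => (-deriv (deriv u) x + q' x * u x) ^ 2) d]
    congr 1; funext x
    by_cases hx : x ∈ s
    · rw [hq x hx]
    · rw [hz x hx]; simp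
  simp only at h4
  rw [e1, e2] at h4
  exact h4

lemma deriv_ofReal_comp (u : ℝ → ℝ) (hu : Differentiable ℝ u) :
    deriv (fun x => ((u x : ℝ) : ℂ)) = fun x => ((deriv u x : ℝ) : ℂ) := by
  funext x
  exact (hu x).hasDerivAt.ofReal_comp.deriv

lemma deriv_re (u : ℝ → ℂ) (hu : Differentiable ℝ u) :
    deriv (fun x => (u x).re) = fun x => (deriv u x).re := by
  funext x
  exact (Complex.reCLM.hasFDerivAt.comp_hasDerivAt x (hu x).hasDerivAt).deriv

lemma deriv_im (u : ℝ → ℂ) (hu : Differentiable ℝ u) :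
    deriv (fun x => (u x).im) = fun x => (deriv u x).im := by
  funext x
  exact (Complex.imCLM.hasFDerivAt.comp_hasDerivAt x (hu x).hasDerivAt).deriv

lemma norm_sq_re_im (z : ℂ) : ‖z‖ ^ 2 = z.re ^ 2 + z.im ^ 2 := by
  rw [← Complex.normSq_eq_norm_sq, Complex.normSq_apply]; ring

lemma not_mem_spec_of_res {V : ℝ → ℝ} (hV : Continuous V) {E c : ℝ} (hc : 0 < c)
    (h : Res univ (fun x => V x - E) c) : E ∉ schrodingerSpectrum V := by
  intro hE
  obtain ⟨u, h1, h2, h3, h4⟩ := hE c hc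
  have d1 : Differentiable ℝ u := h1.differentiable (by norm_num)
  have d2 : Differentiable ℝ (deriv u) := by
    have : ContDiff ℝ (1 + 1) u := by simpa [one_add_one_eq_two] using h1
    exact ((contDiff_succ_iff_deriv (n := 1)).1 this).2.2.differentiable (by norm_num)
  have r1 : ContDiff ℝ 2 (fun x => (u x).re) := Complex.reCLM.contDiff.comp h1
  have i1 : ContDiff ℝ 2 (fun x => (u x).im) := Complex.imCLM.contDiff.comp h1
  have r2 : HasCompactSupport (fun x => (u x).re) := h2.comp_left (g := Complex.re) rfl
  have i2 : HasCompactSupport (fun x => (u x).im) := h2.comp_left (g := Complex.im) rfl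
  have hr := h _ r1 r2 (fun x hx => absurd (mem_univ x) hx)
  have hi := h _ i1 i2 (fun x hx => absurd (mem_univ x) hx)
  have hqc : Continuous (fun x => V x - E) := by fun_prop
  have e1 : (1 : ℝ) = (∫ x, (u x).re ^ 2) + ∫ x, (u x).im ^ 2 := by
    rw [← integral_add (int_sq (c2_cont r1) r2) (int_sq (c2_cont i1) i2), ← h3]
    congr 1; funext x; exact norm_sq_re_im _
  have e2 : (∫ x : ℝ, ‖-deriv (deriv u) x + (V x : ℂ) * u x - (E : ℂ) * u x‖ ^ 2) =
      (∫ x, (-deriv (deriv fun x => (u x).re) x + (V x - E) * (u x).re) ^ 2) +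
      ∫ x, (-deriv (deriv fun x => (u x).im) x + (V x - E) * (u x).im) ^ 2 := by
    rw [← integral_add (int_op hqc r1 r2) (int_op hqc i1 i2)]
    congr 1; funext x
    rw [norm_sq_re_im, deriv_re u d1, deriv_re _ d2, deriv_im u d1, deriv_im _ d2]
    simp
    ring
  rw [e2] at h4
  nlinarith

lemma res_of_not_mem_spec {V : ℝ → ℝ} {E : ℝ} (h : E ∉ schrodingerSpectrum V) :
    ∃ c, 0 < c ∧ Res univ (fun x => V x - E) c := by
  simp only [schrodingerSpectrum, mem_ofPred_eq, not_forall] at h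
  obtain ⟨c, hc, h⟩ := h
  refine ⟨c, hc, ?_⟩
  intro u h1 h2 _
  have hnn : 0 ≤ ∫ x, u x ^ 2 := integral_nonneg fun x => sq_nonneg _
  rcases hnn.eq_or_lt with h0 | h0
  · rw [← h0, mul_zero]; exact integral_nonneg fun x => sq_nonneg _
  push Not at h
  set I := ∫ x, u x ^ 2 with hI
  set a : ℝ := (Real.sqrt I)⁻¹ with ha
  have ha2 : a ^ 2 = I⁻¹ := by rw [ha, inv_pow, Real.sq_sqrt h0.le]
  have hd : Differentiable ℝ (fun x => a * u x) := (c2_diff h1).const_mul a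
  have hdd : deriv (fun x => a * u x) = fun x => a * deriv u x := by
    funext x; exact deriv_const_mul_field a
  have hcast : (fun x => (a : ℂ) * (u x : ℂ)) = fun x => ((a * u x : ℝ) : ℂ) := by
    funext x; push_cast; rfl
  have h5 := h (fun x => ((a * u x : ℝ) : ℂ))
    (Complex.ofRealCLM.contDiff.comp (contDiff_const.mul h1))
    (h2.comp_left (g := fun y : ℝ => ((a * y : ℝ) : ℂ)) (by simp))
    (by
      have : ∀ x, ‖((a * u x : ℝ) : ℂ)‖ ^ 2 = I⁻¹ * u x ^ 2 := by
        intro x; rw [Complex.norm_real, Real.norm_eq_abs, sq_abs, mul_pow, ha2]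
      simp_rw [this]
      rw [integral_const_mul, ← hI]
      exact inv_mul_cancel₀ h0.ne')
  have h6 : ∀ x, ‖-deriv (deriv fun x => ((a * u x : ℝ) : ℂ)) x + (V x : ℂ) * ((a * u x : ℝ) : ℂ)
      - (E : ℂ) * ((a * u x : ℝ) : ℂ)‖ ^ 2 =
      I⁻¹ * (-deriv (deriv u) x + (V x - E) * u x) ^ 2 := by
    intro x
    rw [deriv_ofReal_comp _ hd, hdd, deriv_ofReal_comp _ ((c2_diff' h1).const_mul a)]
    have : deriv (fun x => a * deriv u x) x = a * deriv (deriv u) x := deriv_const_mul_field a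
    beta_reduce
    rw [this, ← ha2]
    have : (-((a * deriv (deriv u) x : ℝ) : ℂ) + (V x : ℂ) * ((a * u x : ℝ) : ℂ)
      - (E : ℂ) * ((a * u x : ℝ) : ℂ)) =
      ((a * (-deriv (deriv u) x + (V x - E) * u x) : ℝ) : ℂ) := by push_cast; ring
    rw [this, Complex.norm_real, Real.norm_eq_abs, sq_abs, mul_pow]
  simp_rw [h6] at h5
  rw [integral_const_mul, inv_mul_eq_div, le_div_iff₀ h0] at h5
  exact h5

lemma eventually_not_mem_spec (V0 : ↥LP) (l0 E0 : ℝ)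
    (h : E0 ∉ schrodingerSpectrum (fun x => l0 * (V0 : ℝ →ᵇ ℝ) x)) :
    ∀ᶠ p : (↥LP × ℝ) × ℝ in 𝓝 ((V0, l0), E0),
      p.2 ∉ schrodingerSpectrum (fun x => p.1.2 * (p.1.1 : ℝ →ᵇ ℝ) x) := by
  obtain ⟨c, hc, hr⟩ := res_of_not_mem_spec h
  set φ : (↥LP × ℝ) × ℝ → ℝ := fun p => |l0 - p.1.2| * ‖(V0 : ℝ →ᵇ ℝ)‖ +
    |p.1.2| * ‖(p.1.1 : ℝ →ᵇ ℝ) - (V0 : ℝ →ᵇ ℝ)‖ + |p.2 - E0| with hφ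
  have hcont : Continuous φ := by fun_prop
  have h0 : φ ((V0, l0), E0) = 0 := by simp [hφ]
  have hs : 0 < Real.sqrt c / 2 := by positivity
  have hev : ∀ᶠ p in 𝓝 ((V0, l0), E0), φ p < Real.sqrt c / 2 :=
    hcont.continuousAt.eventually_lt continuousAt_const (by rw [h0]; exact hs)
  filter_upwards [hev] with p hp
  refine not_mem_spec_of_res (c := c / 4) (by fun_prop) (by positivity) ?_
  refine hr.perturb (a := Real.sqrt c / 2) (by fun_prop) (by fun_prop) ?_ ?_
  · intro x
    refine le_trans ?_ hp.le
    have e1 : l0 * (V0 : ℝ →ᵇ ℝ) x - E0 - (p.1.2 * (p.1.1 : ℝ →ᵇ ℝ) x - p.2) =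
      (l0 - p.1.2) * (V0 : ℝ →ᵇ ℝ) x - p.1.2 * (((p.1.1 : ℝ →ᵇ ℝ) - (V0 : ℝ →ᵇ ℝ)) x)
        + (p.2 - E0) := by simp; ring
    rw [e1]
    have a1 := (V0 : ℝ →ᵇ ℝ).norm_coe_le_norm x
    have a2 := ((p.1.1 : ℝ →ᵇ ℝ) - (V0 : ℝ →ᵇ ℝ)).norm_coe_le_norm x
    rw [Real.norm_eq_abs] at a1 a2
    refine (abs_add_le _ _).trans (add_le_add_left ((abs_sub _ _).trans ?_) _)
    rw [abs_mul, abs_mul]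
    gcongr
  · rw [div_pow, Real.sq_sqrt hc.le]; norm_num

lemma Uset_open (R δ Λ : ℝ) : IsOpen (Uset R δ Λ) := by
  rw [isOpen_iff_mem_nhds]
  intro V0 hV0
  have := IsCompact.eventually_forall_of_forall_eventually (x₀ := V0) (K := Icc Λ⁻¹ Λ)
    isCompact_Icc (P := fun (V : ↥LP) (lam : ℝ) =>
      volume (schrodingerSpectrum (fun x => lam * (V : ℝ →ᵇ ℝ) x) ∩ Set.Icc (-R) R)
      < ENNReal.ofReal δ) ?_
  · exact this
  intro l0 hl0
  have h1 := hV0 l0 hl0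
  obtain ⟨O, hO, hOo, hOm⟩ := Set.exists_isOpen_lt_of_lt _ _ h1
  have h2 := IsCompact.eventually_forall_of_forall_eventually (x₀ := (V0, l0))
    (K := Icc (-R) R \ O) (isCompact_Icc.diff hOo)
    (P := fun (p : ↥LP × ℝ) (E : ℝ) => E ∉ schrodingerSpectrum (fun x => p.2 * (p.1 : ℝ →ᵇ ℝ) x))
    (by
      intro E hE
      refine eventually_not_mem_spec V0 l0 E ?_
      intro hmem
      exact hE.2 (hO ⟨hmem, hE.1⟩))
  filter_upwards [h2] with p hp
  refine lt_of_le_of_lt (measure_mono ?_) hOm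
  rintro E ⟨hE1, hE2⟩
  by_contra hEO
  exact hp E ⟨hE2, hEO⟩ hE1

lemma smoothT_facts : ∃ (s s1 s2 : ℝ → ℝ) (C : ℝ), 1 ≤ C ∧ (∀ x, HasDerivAt s (s1 x) x) ∧
    (∀ x, HasDerivAt s1 (s2 x) x) ∧ Continuous s2 ∧ (∀ x, 0 ≤ s x) ∧ (∀ x, s x ≤ 1) ∧
    (∀ x, |s1 x| ≤ C) ∧ (∀ x, |s2 x| ≤ C) ∧ (∀ x, x ≤ 0 → s x = 0 ∧ s1 x = 0 ∧ s2 x = 0) ∧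
    (∀ x, 1 ≤ x → s x = 1 ∧ s1 x = 0 ∧ s2 x = 0) := by
  have hs : ContDiff ℝ 2 Real.smoothTransition := Real.smoothTransition.contDiff
  set s := Real.smoothTransition with hsdef
  have c1 := c2_cont' hs
  have c2 := c2_cont'' hs
  have z0 : ∀ x, x < 0 → s x = 0 := fun x hx => Real.smoothTransition.zero_of_nonpos hx.le
  have z1 : ∀ x, 1 < x → s x = 1 := fun x hx => Real.smoothTransition.one_of_one_le hx.le
  have d0 : ∀ x, x < 0 → deriv s x = 0 := by
    intro x hx
    have : s =ᶠ[𝓝 x] fun _ => 0 := by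
      filter_upwards [Iio_mem_nhds hx] with y hy using z0 y hy
    rw [this.deriv_eq]; simp
  have d1 : ∀ x, 1 < x → deriv s x = 0 := by
    intro x hx
    have : s =ᶠ[𝓝 x] fun _ => 1 := by
      filter_upwards [Ioi_mem_nhds hx] with y hy using z1 y hy
    rw [this.deriv_eq]; simp
  have dd0 : ∀ x, x < 0 → deriv (deriv s) x = 0 := by
    intro x hx
    have : deriv s =ᶠ[𝓝 x] fun _ => 0 := by
      filter_upwards [Iio_mem_nhds hx] with y hy using d0 y hy
    rw [this.deriv_eq]; simp
  have dd1 : ∀ x, 1 < x → deriv (deriv s) x = 0 := by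
    intro x hx
    have : deriv s =ᶠ[𝓝 x] fun _ => 0 := by
      filter_upwards [Ioi_mem_nhds hx] with y hy using d1 y hy
    rw [this.deriv_eq]; simp
  have ext0 : ∀ g : ℝ → ℝ, Continuous g → (∀ x, x < 0 → g x = 0) → ∀ x, x ≤ 0 → g x = 0 := by
    intro g hg h x hx
    have h1 : IsClosed {x | g x = 0} := isClosed_eq hg continuous_const
    have h2 : Iio (0 : ℝ) ⊆ {x | g x = 0} := h
    have h3 := closure_minimal h2 h1
    rw [closure_Iio] at h3
    exact h3 hx
  have ext1 : ∀ g : ℝ → ℝ, Continuous g → (∀ x, 1 < x → g x = 0) → ∀ x, 1 ≤ x → g x = 0 := by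
    intro g hg h x hx
    have h1 : IsClosed {x | g x = 0} := isClosed_eq hg continuous_const
    have h2 : Ioi (1 : ℝ) ⊆ {x | g x = 0} := h
    have h3 := closure_minimal h2 h1
    rw [closure_Ioi] at h3
    exact h3 hx
  have bd : ∀ g : ℝ → ℝ, Continuous g → (∀ x, x ≤ 0 → g x = 0) → (∀ x, 1 ≤ x → g x = 0) →
      ∃ C, ∀ x, |g x| ≤ C := by
    intro g hg h0 h1
    obtain ⟨C, hC⟩ := (isCompact_Icc (a := (0 : ℝ)) (b := 1)).exists_bound_of_continuousOn
      hg.continuousOn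
    refine ⟨max C 0, fun x => ?_⟩
    rcases le_total x 0 with hx | hx
    · rw [h0 x hx]; simp
    · rcases le_total 1 x with hx1 | hx1
      · rw [h1 x hx1]; simp
      · exact (hC x ⟨hx, hx1⟩).trans (le_max_left _ _)
  obtain ⟨C1, hC1⟩ := bd _ c1 (ext0 _ c1 d0) (ext1 _ c1 d1)
  obtain ⟨C2, hC2⟩ := bd _ c2 (ext0 _ c2 dd0) (ext1 _ c2 dd1)
  refine ⟨s, deriv s, deriv (deriv s), max 1 (max C1 C2), le_max_left _ _,
    fun x => (c2_diff hs x).hasDerivAt, fun x => (c2_diff' hs x).hasDerivAt, c2,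
    Real.smoothTransition.nonneg, Real.smoothTransition.le_one,
    fun x => (hC1 x).trans ((le_max_left _ _).trans (le_max_right _ _)),
    fun x => (hC2 x).trans ((le_max_right _ _).trans (le_max_right _ _)), ?_, ?_⟩
  · intro x hx
    exact ⟨Real.smoothTransition.zero_of_nonpos hx, ext0 _ c1 d0 x hx, ext0 _ c2 dd0 x hx⟩
  · intro x hx
    exact ⟨Real.smoothTransition.one_of_one_le hx, ext1 _ c1 d1 x hx, ext1 _ c2 dd1 x hx⟩

lemma cutoff : ∃ K0 : ℝ, 1 ≤ K0 ∧ ∀ α β : ℝ, ∃ χ χ1 χ2 : ℝ → ℝ,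
    (∀ x, HasDerivAt χ (χ1 x) x) ∧ (∀ x, HasDerivAt χ1 (χ2 x) x) ∧ Continuous χ2 ∧
    (∀ x, |χ x| ≤ 1) ∧ (∀ x, |χ1 x| ≤ K0) ∧ (∀ x, |χ2 x| ≤ K0) ∧
    (∀ x, x ∉ Ioo α β → χ x = 0 ∧ χ1 x = 0 ∧ χ2 x = 0) ∧
    (∀ x, x ∈ Icc (α + 1) (β - 1) → χ x = 1 ∧ χ1 x = 0 ∧ χ2 x = 0) := by
  obtain ⟨s, s1, s2, C, hC, h1, h2, h3, h4, h5, h6, h7, h8, h9⟩ := smoothT_facts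
  refine ⟨4 * C ^ 2, by nlinarith, fun α β => ?_⟩
  refine ⟨fun x => s (x - α) * s (β - x), fun x => s1 (x - α) * s (β - x) - s (x - α) * s1 (β - x),
    fun x => s2 (x - α) * s (β - x) - 2 * (s1 (x - α) * s1 (β - x)) + s (x - α) * s2 (β - x),
    ?_, ?_, ?_, ?_, ?_, ?_, ?_, ?_⟩
  · intro x
    have a1 := (h1 (x - α)).comp_sub_const x α
    have a2 := (h1 (β - x)).comp_const_sub β x
    exact (a1.mul a2).congr_deriv (by ring)
  · intro x
    have a1 := (h1 (x - α)).comp_sub_const x α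
    have a2 := (h1 (β - x)).comp_const_sub β x
    have b1 := (h2 (x - α)).comp_sub_const x α
    have b2 := (h2 (β - x)).comp_const_sub β x
    exact ((b1.mul a2).sub (a1.mul b2)).congr_deriv (by ring)
  · have k1 : Continuous s := continuous_iff_continuousAt.2 fun x => (h1 x).continuousAt
    have k2 : Continuous s1 := continuous_iff_continuousAt.2 fun x => (h2 x).continuousAt
    fun_prop
  · intro x
    have := h4 (x - α); have := h4 (β - x); have := h5 (x - α); have := h5 (β - x)
    rw [abs_of_nonneg (by positivity)]; nlinarith
  · intro x
    have e1 := h4 (x - α); have e2 := h4 (β - x); have e3 := h5 (x - α); have e4 := h5 (β - x)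
    refine (abs_sub _ _).trans ?_
    rw [abs_mul, abs_mul, abs_of_nonneg e1, abs_of_nonneg e2]
    nlinarith [h6 (x - α), h6 (β - x), abs_nonneg (s1 (x - α)), abs_nonneg (s1 (β - x)),
      mul_le_mul (h6 (x - α)) e4 e2 (by linarith), mul_le_mul e3 (h6 (β - x)) (abs_nonneg _) (by linarith)]
  · intro x
    have e1 := h4 (x - α); have e2 := h4 (β - x); have e3 := h5 (x - α); have e4 := h5 (β - x)
    refine (abs_add_le _ _).trans ((add_le_add_left (abs_sub _ _) _).trans ?_)
    simp only [abs_mul]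
    rw [abs_of_nonneg e1, abs_of_nonneg e2, abs_of_nonneg (by norm_num : (0 : ℝ) ≤ 2)]
    have f1 := mul_le_mul (h7 (x - α)) e4 e2 (by linarith)
    have f2 := mul_le_mul e3 (h7 (β - x)) (abs_nonneg _) (by linarith)
    have f3 := mul_le_mul (h6 (x - α)) (h6 (β - x)) (abs_nonneg _) (by linarith)
    nlinarith
  · intro x hx
    have : x - α ≤ 0 ∨ β - x ≤ 0 := by
      by_contra hcon
      push Not at hcon
      exact hx ⟨by linarith, by linarith⟩
    rcases this with h | h <;> obtain ⟨i, j, k⟩ := h8 _ h <;> simp [i, j, k]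
  · intro x hx
    obtain ⟨i, j, k⟩ := h9 (x - α) (by linarith [hx.1])
    obtain ⟨i', j', k'⟩ := h9 (β - x) (by linarith [hx.2])
    simp [i, j, k, i', j', k']

lemma holefill (B : ℝ) (hB : 0 ≤ B) : ∃ K : ℝ, 1 ≤ K ∧ ∀ (q : ℝ → ℝ), Continuous q →
    (∀ x, |q x| ≤ B) → ∀ α β : ℝ, α + 1 ≤ β - 1 → ∀ c, Res (Ioo α β) q c →
    0 ≤ c → ∀ u, ContDiff ℝ 2 u →
    c * (∫ x in (α + 1)..(β - 1), u x ^ 2) ≤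
      K * ((∫ x in α..β, (-deriv (deriv u) x + q x * u x) ^ 2) + (∫ x in α..β, u x ^ 2)
        - ∫ x in (α + 1)..(β - 1), u x ^ 2) := by
  obtain ⟨K0, hK0, hcut⟩ := cutoff
  refine ⟨3 + 63 * K0 ^ 2 + 12 * (2 * B + 1) * K0 ^ 2, by nlinarith [sq_nonneg K0, mul_nonneg hB (sq_nonneg K0)], ?_⟩
  set K := 3 + 63 * K0 ^ 2 + 12 * (2 * B + 1) * K0 ^ 2 with hK
  intro q hq hqB α β hαβ c hR hc u hu
  obtain ⟨χ, χ1, χ2, h1, h2, h3, b0, b1, b2, hz, ho⟩ := hcut α β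
  have kχ : Continuous χ := continuous_iff_continuousAt.2 fun x => (h1 x).continuousAt
  have kχ1 : Continuous χ1 := continuous_iff_continuousAt.2 fun x => (h2 x).continuousAt
  have ku := c2_cont hu
  have ku1 := c2_cont' hu
  have ku2 := c2_cont'' hu
  have g1 : ∀ x, HasDerivAt u (deriv u x) x := fun x => (c2_diff hu x).hasDerivAt
  have g2 : ∀ x, HasDerivAt (deriv u) (deriv (deriv u) x) x := fun x => (c2_diff' hu x).hasDerivAt
  set u1 := deriv u with hu1
  set u2 := deriv u1 with hu2
  have dχ : deriv χ = χ1 := funext fun x => (h1 x).deriv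
  have dχ1 : deriv χ1 = χ2 := funext fun x => (h2 x).deriv
  have cχ : ContDiff ℝ 2 χ := by
    have : ContDiff ℝ (1 + 1) χ := by
      refine (contDiff_succ_iff_deriv (n := 1)).2 ⟨fun x => (h1 x).differentiableAt, by simp, ?_⟩
      rw [dχ]
      exact contDiff_one_iff_deriv.2 ⟨fun x => (h2 x).differentiableAt, by rw [dχ1]; exact h3⟩
    simpa [one_add_one_eq_two] using this
  have csχ : HasCompactSupport χ := by
    refine HasCompactSupport.intro (isCompact_Icc (a := α) (b := β)) fun x hx => ?_
    exact (hz x fun h => hx ⟨h.1.le, h.2.le⟩).1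
  have dg : deriv (fun x => χ x * u x) = fun x => χ1 x * u x + χ x * u1 x :=
    funext fun x => ((h1 x).mul (g1 x)).deriv
  have ddg : deriv (deriv (fun x => χ x * u x)) =
      fun x => χ2 x * u x + 2 * (χ1 x * u1 x) + χ x * u2 x := by
    rw [dg]; funext x
    refine (((h2 x).mul (g1 x)).add ((h1 x).mul (g2 x))).deriv.trans ?_
    ring
  have hR' := hR (fun x => χ x * u x) (cχ.mul hu) (csχ.mul_right)
    (fun x hx => by simp [(hz x hx).1])
  rw [ddg] at hR'
  beta_reduce at hR'
  have ii : ∀ f : ℝ → ℝ, Continuous f → ∀ a b : ℝ, IntervalIntegrable f volume a b :=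
    fun f hf a b => hf.intervalIntegrable a b
  have L1 : ∫ x in (α + 1)..(β - 1), u x ^ 2 ≤ ∫ x, (χ x * u x) ^ 2 := by
    rw [intervalIntegral.integral_of_le hαβ]
    have : ∫ x in Ioc (α + 1) (β - 1), u x ^ 2 = ∫ x in Ioc (α + 1) (β - 1), (χ x * u x) ^ 2 := by
      refine setIntegral_congr_fun measurableSet_Ioc fun x hx => ?_
      simp [(ho x ⟨hx.1.le, hx.2⟩).1]
    rw [this]
    refine setIntegral_le_integral ?_ (Eventually.of_forall fun x => sq_nonneg _)
    exact int_sq (kχ.mul ku) (csχ.mul_right)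
  set P : ℝ → ℝ := fun x => (3 * χ x ^ 2 + 12 * χ1 x ^ 2) * (-u2 x + q x * u x) ^ 2 +
    (51 * χ2 x ^ 2 + 12 * (2 * B + 1) * χ1 x ^ 2) * u x ^ 2 with hP
  have kP : Continuous P := by fun_prop
  set D : ℝ → ℝ := fun x => χ1 x ^ 2 * (u x * u1 x) with hD
  set D1 : ℝ → ℝ := fun x => 2 * χ1 x * χ2 x * u x * u1 x + χ1 x ^ 2 * u1 x ^ 2
    + χ1 x ^ 2 * (u x * u2 x) with hD1
  have kD1 : Continuous D1 := by fun_prop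
  have hDD : ∀ x, HasDerivAt D (D1 x) x := by
    intro x
    refine (((h2 x).pow 2).mul ((g1 x).mul (g2 x))).congr_deriv ?_
    simp only [hD1]; push_cast; simp; ring
  have L2 : ∫ x, (-(χ2 x * u x + 2 * (χ1 x * u1 x) + χ x * u2 x) + q x * (χ x * u x)) ^ 2
      = ∫ x in α..β, (-(χ2 x * u x + 2 * (χ1 x * u1 x) + χ x * u2 x) + q x * (χ x * u x)) ^ 2 := by
    rw [intervalIntegral.integral_eq_integral_of_support_subset]
    intro x hx
    by_contra hx'
    obtain ⟨i, j, k⟩ := hz x fun h => hx' ⟨h.1, h.2.le⟩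
    exact hx (by simp [i, j, k])
  have L3 : ∫ x in α..β, (-(χ2 x * u x + 2 * (χ1 x * u1 x) + χ x * u2 x) + q x * (χ x * u x)) ^ 2
      ≤ ∫ x in α..β, (24 * D1 x + P x) := by
    refine intervalIntegral.integral_mono_on (by linarith) (ii _ (by fun_prop) _ _)
      (ii _ (by fun_prop) _ _) fun x _ => ?_
    simp only [hD1, hP]
    have q1 := neg_le_of_abs_le (hqB x)
    have q2 : 0 ≤ (B + q x) * (χ1 x * u x) ^ 2 := mul_nonneg (by linarith) (sq_nonneg _)
    set f := -u2 x + q x * u x with hf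
    have e : u2 x = q x * u x - f := by rw [hf]; ring
    rw [e]
    nlinarith [sq_nonneg (χ x * f + 2 * χ1 x * u1 x), sq_nonneg (χ x * f + χ2 x * u x),
      sq_nonneg (2 * χ1 x * u1 x - χ2 x * u x), sq_nonneg (χ1 x * u1 x + 2 * χ2 x * u x),
      sq_nonneg (χ1 x * u x - χ1 x * f)]
  have L4 : ∫ x in α..β, (24 * D1 x + P x) = ∫ x in α..β, P x := by
    rw [intervalIntegral.integral_add (ii _ (by fun_prop) _ _) (ii _ kP _ _),
      intervalIntegral.integral_const_mul,
      intervalIntegral.integral_eq_sub_of_hasDerivAt (fun x _ => hDD x) (ii _ kD1 _ _)]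
    have : D β = 0 := by simp [hD, (hz β (by simp)).2.1]
    have : D α = 0 := by simp [hD, (hz α (by simp)).2.1]
    simp [*]
  have sqb : ∀ y b : ℝ, |y| ≤ b → y ^ 2 ≤ b ^ 2 := fun y b h => sq_le_sq' (neg_le_of_abs_le h)
    (le_of_abs_le h)
  have pb : ∀ x, P x ≤ K * ((-u2 x + q x * u x) ^ 2 + u x ^ 2) := by
    intro x
    have t0 := sqb _ _ (b0 x); have t1 := sqb _ _ (b1 x); have t2 := sqb _ _ (b2 x)
    have r1 : 3 * χ x ^ 2 + 12 * χ1 x ^ 2 ≤ K := by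
      rw [hK]; nlinarith [mul_nonneg hB (sq_nonneg K0), sq_nonneg K0]
    have r2 : 51 * χ2 x ^ 2 + 12 * (2 * B + 1) * χ1 x ^ 2 ≤ K := by
      have := mul_le_mul_of_nonneg_left t1 (by linarith : 0 ≤ 12 * (2 * B + 1))
      rw [hK]; nlinarith [sq_nonneg K0]
    have := mul_le_mul_of_nonneg_right r1 (sq_nonneg (-u2 x + q x * u x))
    have := mul_le_mul_of_nonneg_right r2 (sq_nonneg (u x))
    simp only [hP]; linarith
  have pb' : ∀ x ∈ Icc (α + 1) (β - 1), P x ≤ K * (-u2 x + q x * u x) ^ 2 := by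
    intro x hx
    obtain ⟨i, j, k⟩ := ho x hx
    have r1 : 3 ≤ K := by rw [hK]; nlinarith [mul_nonneg hB (sq_nonneg K0), sq_nonneg K0]
    simp only [hP, i, j, k]
    nlinarith [sq_nonneg (-u2 x + q x * u x)]
  have M1 : ∀ a b : ℝ, a ≤ b → ∫ x in a..b, P x ≤
      K * ((∫ x in a..b, (-u2 x + q x * u x) ^ 2) + ∫ x in a..b, u x ^ 2) := by
    intro a b hab
    rw [← intervalIntegral.integral_add (ii _ (by fun_prop) _ _) (ii _ (by fun_prop) _ _),
      ← intervalIntegral.integral_const_mul]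
    exact intervalIntegral.integral_mono_on hab (ii _ kP _ _) (ii _ (by fun_prop) _ _)
      fun x _ => pb x
  have M2 : ∫ x in (α + 1)..(β - 1), P x ≤
      K * (∫ x in (α + 1)..(β - 1), (-u2 x + q x * u x) ^ 2) := by
    rw [← intervalIntegral.integral_const_mul]
    exact intervalIntegral.integral_mono_on hαβ (ii _ kP _ _) (ii _ (by fun_prop) _ _) pb'
  have split : ∀ f : ℝ → ℝ, Continuous f → ∫ x in α..β, f x = (∫ x in α..(α + 1), f x) +
      (∫ x in (α + 1)..(β - 1), f x) + ∫ x in (β - 1)..β, f x := by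
    intro f hf
    rw [intervalIntegral.integral_add_adjacent_intervals (ii f hf _ _) (ii f hf _ _),
      intervalIntegral.integral_add_adjacent_intervals (ii f hf _ _) (ii f hf _ _)]
  have N1 := M1 α (α + 1) (by linarith)
  have N2 := M1 (β - 1) β (by linarith)
  have S1 := split P kP
  have S2 := split (fun x => (-u2 x + q x * u x) ^ 2) (by fun_prop)
  have S3 := split (fun x => u x ^ 2) (by fun_prop)
  have := mul_le_mul_of_nonneg_left L1 hc
  rw [L2] at hR'
  rw [S2, S3]
  linarith


lemma cell_sum {g : ℝ → ℝ} (hg : Integrable g) {L : ℝ} (hL : 0 < L) (a : ℝ) :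
    HasSum (fun j : ℤ => ∫ x in (a + j * L)..(a + j * L + L), g x) (∫ x, g x) := by
  have h := hasSum_integral_iUnion (μ := volume) (f := g)
    (s := fun n : ℤ => Ioc (a + n • L) (a + (n + 1) • L))
    (fun i => measurableSet_Ioc) (pairwise_disjoint_Ioc_add_zsmul a L) (hg.integrableOn)
  rw [iUnion_Ioc_add_zsmul hL] at h
  simp only [Measure.restrict_univ] at h
  have e : (fun j : ℤ => ∫ x in (a + j * L)..(a + j * L + L), g x) =
      fun n : ℤ => ∫ x in Ioc (a + n • L) (a + (n + 1) • L), g x := by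
    funext j
    rw [intervalIntegral.integral_of_le (by linarith)]
    simp only [zsmul_eq_mul]; push_cast
    rw [add_one_mul, add_assoc]
  rw [e]
  exact h

lemma decay_it (E : ℕ → ℝ) (F K c : ℝ) (hK : 0 < K) (hc : 0 < c) (N : ℕ)
    (h : ∀ i, i < N → (c + K) * E i ≤ K * (E (i + 1) + F)) :
    ∀ m, m ≤ N → E 0 ≤ (K / (K + c)) ^ m * E m + K / c * (1 - (K / (K + c)) ^ m) * F := by
  intro m
  induction m with
  | zero => intro _; simp
  | succ m ih =>
    intro hm
    have h1 := ih (by omega)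
    have h2 := h m (by omega)
    have hp : 0 < K + c := by linarith
    set ρ := K / (K + c) with hρ
    have hρ0 : 0 < ρ := by positivity
    have h3 : E m ≤ ρ * (E (m + 1) + F) := by
      rw [hρ, div_mul_eq_mul_div, le_div_iff₀ hp]; linarith
    have h4 := mul_le_mul_of_nonneg_left h3 (pow_pos hρ0 m).le
    have h5 : K / c * (1 - ρ) = ρ := by rw [hρ]; field_simp; ring
    calc E 0 ≤ _ := h1
      _ ≤ ρ ^ m * (ρ * (E (m + 1) + F)) + K / c * (1 - ρ ^ m) * F := by linarith
      _ = ρ ^ (m + 1) * E (m + 1) + (K / c * (1 - ρ ^ m) + ρ ^ m * ρ) * F := by ring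
      _ = ρ ^ (m + 1) * E (m + 1) + (K / c * (1 - ρ ^ m) + ρ ^ m * (K / c * (1 - ρ))) * F := by
          rw [h5]
      _ = _ := by ring

lemma cell_res (B : ℝ) (hB : 0 ≤ B) : ∃ K : ℝ, 1 ≤ K ∧ ∀ (q : ℝ → ℝ), Continuous q →
    (∀ x, |q x| ≤ B) → ∀ (L : ℝ), Function.Periodic q L → ∀ (a : ℝ) (n : ℕ) (c η : ℝ),
    0 < c → 0 < η → 2 * n + 6 ≤ L → Res (Ioo (a - (n + 2)) (a + (n + 2))) q c →
    Res (Ioo a (a + L)) q (η ^ 2) → 16 * K * (K / (K + c)) ^ n ≤ η ^ 2 →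
    (K / (K + c)) ^ n ≤ 1 / 16 → ∃ c', 0 < c' ∧ Res univ q c' := by
  obtain ⟨K, hK, hh⟩ := holefill B hB
  refine ⟨K, hK, ?_⟩
  intro q hq hqB L hL a n c η hc hη hnL hR1 hR2 hρη hρ16
  have hK0 : 0 < K := by linarith
  have hn0 : (0 : ℝ) ≤ n := Nat.cast_nonneg n
  have hL0 : 0 < L := by linarith
  set ρ := K / (K + c) with hρ
  have hρ0 : 0 < ρ := by positivity
  have hρn := pow_pos hρ0 n
  have hη2 : 0 < η ^ 2 := by positivity
  have hper : ∀ (j : ℤ) (x : ℝ), q (x + j * L) = q x := fun j x => by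
    have := hL.zsmul j x
    simpa using this
  set A := K / η ^ 2 with hA
  have hA0 : 0 < A := by positivity
  set C := 2 * (A + (A + 1) * (4 * (K / c))) with hC
  have hC0 : 0 < C := by positivity
  refine ⟨C⁻¹, by positivity, ?_⟩
  intro u hu hcs _
  have ku := c2_cont hu
  have kf : Continuous (fun x => -deriv (deriv u) x + q x * u x) := by
    have := c2_cont'' hu; fun_prop
  have i1 : Integrable (fun x => u x ^ 2) := int_sq ku hcs
  have i2 : Integrable (fun x => (-deriv (deriv u) x + q x * u x) ^ 2) := int_op hq hu hcs
  set g : ℝ → ℝ := fun x => u x ^ 2 with hg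
  set f : ℝ → ℝ := fun x => (-deriv (deriv u) x + q x * u x) ^ 2 with hf
  have kg : Continuous g := by fun_prop
  have kff : Continuous f := by fun_prop
  have g0 : ∀ x, 0 ≤ g x := fun x => sq_nonneg _
  have f0 : ∀ x, 0 ≤ f x := fun x => sq_nonneg _
  have s1 := cell_sum i1 hL0 a
  have s2 := cell_sum i2 hL0 a
  have mono : ∀ (g : ℝ → ℝ), Continuous g → (∀ x, 0 ≤ g x) → ∀ a b a' b' : ℝ, a' ≤ a → a ≤ b → b ≤ b' →
      ∫ x in a..b, g x ≤ ∫ x in a'..b', g x := by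
    intro g kg g0 a b a' b' h1 h2 h3
    exact intervalIntegral.integral_mono_interval h1 h2 h3 (Eventually.of_forall g0)
      (kg.intervalIntegrable _ _)
  have adj : ∀ (g : ℝ → ℝ), Continuous g → ∀ a b c : ℝ, (∫ x in a..b, g x) + ∫ x in b..c, g x = ∫ x in a..c, g x :=
    fun g kg a b c => intervalIntegral.integral_add_adjacent_intervals
      (kg.intervalIntegrable _ _) (kg.intervalIntegrable _ _)
  set M : ℤ → ℝ := fun j => ∫ x in (a + j * L)..(a + j * L + L), g x with hM
  set F : ℤ → ℝ := fun j => ∫ x in (a + j * L)..(a + j * L + L), f x with hF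
  -- two neighbouring cells
  have two : ∀ (g : ℝ → ℝ), Continuous g → (∀ x, 0 ≤ g x) → ∀ (j : ℤ) (r : ℝ), 0 ≤ r → r ≤ L →
      ∫ x in (a + j * L - r)..(a + j * L + r), g x ≤
      (∫ x in (a + (j - 1 : ℤ) * L)..(a + (j - 1 : ℤ) * L + L), g x) +
        ∫ x in (a + j * L)..(a + j * L + L), g x := by
    intro g kg g0 j r hr hrL
    have : a + (j - 1 : ℤ) * L + L = a + j * L := by push_cast; ring
    rw [this, adj g kg]
    refine mono g kg g0 _ _ _ _ ?_ ?_ ?_ <;> push_cast <;> linarith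
  have e1 : ∀ j : ℤ, ∫ x in (a + j * L - 1)..(a + j * L + 1), g x ≤
      ρ ^ n * (M (j - 1) + M j) + K / c * (F (j - 1) + F j) := by
    intro j
    set b := a + j * L with hb
    have hRj : Res (Ioo (b - (n + 2)) (b + (n + 2))) q c := by
      refine Res.translate hR1 (d := j * L) ?_ fun x _ => hper j x
      intro x hx
      exact ⟨by linarith [hx.1], by linarith [hx.2]⟩
    set F' := ∫ x in (b - (n + 2))..(b + (n + 2)), f x with hF'
    have hF'0 : 0 ≤ F' := intervalIntegral.integral_nonneg (by linarith) fun x _ => f0 x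
    have key := decay_it (fun i => ∫ x in (b - (i + 1))..(b + (i + 1)), g x) F' K c hK0 hc n (by
      intro i hi
      have hi' : (i : ℝ) + 1 ≤ n := by exact_mod_cast hi
      have hi0 : (0 : ℝ) ≤ i := Nat.cast_nonneg i
      have h1 := hh q hq hqB (b - (i + 2)) (b + (i + 2)) (by linarith) c
        (hRj.mono (Ioo_subset_Ioo (by linarith) (by linarith))) hc.le u hu
      have h2 : ∫ x in (b - (i + 2))..(b + (i + 2)), f x ≤ F' :=
        mono f kff f0 _ _ _ _ (by linarith) (by linarith) (by linarith)
      have h3 := mul_le_mul_of_nonneg_left h2 hK0.le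
      have r1 : b - ((i : ℝ) + 2) + 1 = b - (i + 1) := by ring
      have r2 : b + ((i : ℝ) + 2) - 1 = b + (i + 1) := by ring
      rw [r1, r2] at h1
      beta_reduce
      push_cast
      have r3 : ((i : ℝ) + 1 + 1) = i + 2 := by ring
      rw [r3]
      linarith) n le_rfl
    beta_reduce at key
    simp only [Nat.cast_zero, zero_add] at key
    refine key.trans ?_
    refine add_le_add ?_ ?_
    · exact mul_le_mul_of_nonneg_left (two g kg g0 j _ (by linarith) (by linarith)) hρn.le
    · have t1 : F' ≤ F (j - 1) + F j := two f kff f0 j _ (by linarith) (by linarith)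
      have t2 : K / c * (1 - ρ ^ n) ≤ K / c := by
        have : 0 < K / c := by positivity
        nlinarith
      exact mul_le_mul t2 t1 hF'0 (by positivity)
  have m1 : ∀ j : ℤ, M j ≤ A * F j + (A + 1) * ((∫ x in (a + j * L - 1)..(a + j * L + 1), g x)
      + ∫ x in (a + (j + 1 : ℤ) * L - 1)..(a + (j + 1 : ℤ) * L + 1), g x) := by
    intro j
    set b := a + j * L with hb
    have hb' : a + (j + 1 : ℤ) * L = b + L := by push_cast; rw [hb]; ring
    rw [hb']
    have hRj : Res (Ioo b (b + L)) q (η ^ 2) := by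
      refine Res.translate hR2 (d := j * L) ?_ fun x _ => hper j x
      intro x hx
      exact ⟨by linarith [hx.1], by linarith [hx.2]⟩
    have h1 := hh q hq hqB b (b + L) (by linarith) _ hRj hη2.le u hu
    have h2 : M j = (∫ x in b..(b + 1), g x) + (∫ x in (b + 1)..(b + L - 1), g x)
        + ∫ x in (b + L - 1)..(b + L), g x := by
      rw [adj g kg, adj g kg]
    have h3 := mono g kg g0 b (b + 1) (b - 1) (b + 1) (by linarith) (by linarith) le_rfl
    have h4 := mono g kg g0 (b + L - 1) (b + L) (b + L - 1) (b + L + 1) le_rfl (by linarith) (by linarith)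
    set I := ∫ x in (b + 1)..(b + L - 1), g x
    set S := (∫ x in (b - 1)..(b + 1), g x) + ∫ x in (b + L - 1)..(b + L + 1), g x
    have h5 : M j - I ≤ S := by linarith
    have h6 : I ≤ A * (F j + (M j - I)) := by
      rw [hA, div_mul_eq_mul_div, le_div_iff₀ hη2]
      calc I * η ^ 2 = η ^ 2 * I := by ring
        _ ≤ _ := h1
        _ = _ := by rw [add_sub_assoc]
    nlinarith
  have hAρ : (A + 1) * ρ ^ n ≤ 1 / 8 := by
    have : A * ρ ^ n ≤ 1 / 16 := by
      rw [hA, div_mul_eq_mul_div, div_le_iff₀ hη2]; linarith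
    linarith
  have hM0 : ∀ j, 0 ≤ M j := fun j => intervalIntegral.integral_nonneg (by linarith) fun x _ => g0 x
  have hF0 : ∀ j, 0 ≤ F j := fun j => intervalIntegral.integral_nonneg (by linarith) fun x _ => f0 x
  have m2 : ∀ j : ℤ, M j ≤ A * F j + 1 / 8 * (M (j - 1) + 2 * M j + M (j + 1)) +
      (A + 1) * (K / c) * (F (j - 1) + 2 * F j + F (j + 1)) := by
    intro j
    have t0 := m1 j
    have t1 := e1 j
    have t2 := e1 (j + 1)
    rw [add_sub_cancel_right] at t2
    have t3 := mul_le_mul_of_nonneg_left (add_le_add t1 t2) (by linarith : 0 ≤ A + 1)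
    have t4 := mul_le_mul_of_nonneg_right hAρ (by linarith [hM0 (j-1), hM0 j, hM0 (j+1)] :
      0 ≤ M (j - 1) + 2 * M j + M (j + 1))
    nlinarith
  have sh : ∀ {G : ℤ → ℝ} {S : ℝ}, HasSum G S → ∀ k : ℤ, HasSum (fun j => G (j + k)) S :=
    fun h k => (Equiv.addRight k).hasSum_iff.2 h
  have T := hasSum_le m2 s1 (((s2.mul_left A).add ((((sh s1 (-1)).add (s1.mul_left 2)).add (sh s1 1)).mul_left (1/8))).add
    ((((sh s2 (-1)).add (s2.mul_left 2)).add (sh s2 1)).mul_left ((A + 1) * (K / c))))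
  rw [inv_mul_le_iff₀ hC0]
  rw [hC]
  linarith


lemma separated {S : Set ℝ} {s : ℝ} (hs : 0 < s) (p : ℕ) (h : ENNReal.ofReal (2 * s * p) < volume S) :
    ∀ k, k ≤ p + 1 → ∃ e : ℕ → ℝ, (∀ i < k, e i ∈ S) ∧
      ∀ i < k, ∀ j < k, i ≠ j → s ≤ |e i - e j| := by
  intro k
  induction k with
  | zero => intro _; exact ⟨fun _ => 0, by simp, by simp⟩
  | succ k ih =>
    intro hk
    obtain ⟨e, h1, h2⟩ := ih (by omega)
    have : ∃ x ∈ S, ∀ i < k, s ≤ |e i - x| := by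
      by_contra hcon
      push Not at hcon
      have hsub : S ⊆ ⋃ i ∈ Finset.range k, Icc (e i - s) (e i + s) := by
        intro x hx
        obtain ⟨i, hi, hix⟩ := hcon x hx
        simp only [mem_iUnion]
        obtain ⟨a, b⟩ := abs_lt.1 hix
        exact ⟨i, Finset.mem_range.2 hi, by constructor <;> linarith⟩
      have : volume S ≤ ENNReal.ofReal (2 * s * p) := by
        refine (measure_mono hsub).trans ((measure_biUnion_finset_le _ _).trans ?_)
        simp only [Real.volume_Icc]
        have e1 : ∀ i, e i + s - (e i - s) = 2 * s := fun i => by ring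
        simp only [e1, Finset.sum_const, Finset.card_range, nsmul_eq_mul]
        rw [← ENNReal.ofReal_natCast, ← ENNReal.ofReal_mul (by positivity)]
        refine ENNReal.ofReal_le_ofReal ?_
        have : (k : ℝ) ≤ p := by exact_mod_cast (by omega : k ≤ p)
        nlinarith
      exact absurd h (not_lt.2 this)
    obtain ⟨x, hx, hx2⟩ := this
    refine ⟨Function.update e k x, ?_, ?_⟩
    · intro i hi
      rcases eq_or_ne i k with rfl | hik
      · simpa using hx
      · rw [Function.update_of_ne hik]; exact h1 i (by omega)
    · intro i hi j hj hij
      rcases eq_or_ne i k with rfl | hik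
      · rw [Function.update_of_ne (Ne.symm hij)]
        simp only [Function.update_self]
        rw [abs_sub_comm]; exact hx2 j (by omega)
      · rw [Function.update_of_ne hik]
        rcases eq_or_ne j k with rfl | hjk
        · simp only [Function.update_self]; exact hx2 i (by omega)
        · rw [Function.update_of_ne hjk]; exact h2 i (by omega) j (by omega) hij

lemma poinc {v : ℝ → ℝ} (hv : ContDiff ℝ 2 v) {α β : ℝ} (h : α ≤ β) (h0 : v α = 0) :
    ∫ x in α..β, v x ^ 2 ≤ (β - α) ^ 2 * ∫ x in α..β, deriv v x ^ 2 := by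
  have k0 := c2_cont hv
  have k1 := c2_cont' hv
  have pt : ∀ x ∈ Icc α β, v x ^ 2 ≤ (β - α) * ∫ x in α..β, deriv v x ^ 2 := by
    intro x hx
    have hI : 0 ≤ ∫ x in α..β, deriv v x ^ 2 :=
      intervalIntegral.integral_nonneg h fun _ _ => sq_nonneg _
    rcases eq_or_lt_of_le hx.1 with rfl | hlt
    · rw [h0]; simp; exact mul_nonneg (by linarith) hI
    have hI' : ∫ y in α..x, deriv v y ^ 2 ≤ ∫ x in α..β, deriv v x ^ 2 :=
      intervalIntegral.integral_mono_interval le_rfl hx.1 hx.2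
        (Eventually.of_forall fun _ => sq_nonneg _) ((k1.pow 2).intervalIntegrable _ _)
    have hF : ∫ y in α..x, deriv v y = v x := by
      rw [intervalIntegral.integral_eq_sub_of_hasDerivAt
        (fun y _ => (c2_diff hv y).hasDerivAt) (k1.intervalIntegrable _ _), h0, sub_zero]
    set m := v x / (x - α) with hm
    have hxa : 0 < x - α := by linarith
    have hmm : m * (x - α) = v x := div_mul_cancel₀ _ hxa.ne'
    have P : 0 ≤ ∫ y in α..x, (deriv v y - m) ^ 2 :=
      intervalIntegral.integral_nonneg hx.1 fun _ _ => sq_nonneg _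
    have e : ∫ y in α..x, (deriv v y - m) ^ 2 =
        (∫ y in α..x, deriv v y ^ 2) - 2 * m * (∫ y in α..x, deriv v y) + m ^ 2 * (x - α) := by
      have : ∀ y, (deriv v y - m) ^ 2 = deriv v y ^ 2 - 2 * m * deriv v y + m ^ 2 := fun y => by ring
      simp only [this]
      rw [intervalIntegral.integral_add, intervalIntegral.integral_sub,
        intervalIntegral.integral_const_mul, intervalIntegral.integral_const, smul_eq_mul, mul_comm (x - α)]
      all_goals exact Continuous.intervalIntegrable (by fun_prop) _ _
    rw [e, hF] at P
    have P2 : m * v x ≤ ∫ y in α..x, deriv v y ^ 2 := by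
      have : m ^ 2 * (x - α) = m * v x := by rw [← hmm]; ring
      linarith
    have P3 := mul_le_mul_of_nonneg_left P2 hxa.le
    have : (x - α) * (m * v x) = v x ^ 2 := by rw [← hmm]; ring
    rw [this] at P3
    refine P3.trans ?_
    exact mul_le_mul (by linarith [hx.2]) hI'
      (intervalIntegral.integral_nonneg hx.1 fun _ _ => sq_nonneg _) (by linarith)
  have := intervalIntegral.integral_mono_on (μ := volume) h ((k0.pow 2).intervalIntegrable _ _)
    (continuous_const.intervalIntegrable _ _) pt
  rw [intervalIntegral.integral_const, smul_eq_mul] at this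
  refine this.trans (le_of_eq ?_); ring

lemma poinc_grid {v : ℝ → ℝ} (hv : ContDiff ℝ 2 v) (hc : HasCompactSupport v) {a L : ℝ} (hL : 0 < L)
    {p : ℕ} (hp : 1 ≤ p) (hs : ∀ x, x ∉ Ioo a (a + L) → v x = 0)
    (hg : ∀ k : ℕ, k < p → v (a + k * (L / p)) = 0) :
    ∫ x, v x ^ 2 ≤ (L / p) ^ 2 * ∫ x, deriv v x ^ 2 := by
  have k0 := c2_cont hv
  have k1 := c2_cont' hv
  have hp0 : (0 : ℝ) < p := by exact_mod_cast hp
  have hLp : 0 < L / p := by positivity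
  have e1 : ∫ x, v x ^ 2 = ∫ x in a..(a + L), v x ^ 2 := by
    rw [intervalIntegral.integral_eq_integral_of_support_subset]
    intro x hx
    by_contra hx'
    exact hx (by simp [hs x fun h => hx' ⟨h.1, h.2.le⟩])
  have e2 : ∫ x in a..(a + L), deriv v x ^ 2 ≤ ∫ x, deriv v x ^ 2 := by
    rw [intervalIntegral.integral_of_le (by linarith)]
    exact setIntegral_le_integral (int_sq k1 hc.deriv) (Eventually.of_forall fun x => sq_nonneg _)
  have sp : ∀ f : ℝ → ℝ, Continuous f → ∑ k ∈ Finset.range p,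
      ∫ x in (a + k * (L / p))..(a + (k + 1 : ℕ) * (L / p)), f x = ∫ x in a..(a + L), f x := by
    intro f hf
    rw [intervalIntegral.sum_integral_adjacent_intervals (a := fun k : ℕ => a + k * (L / p))
      fun k _ => hf.intervalIntegrable _ _]
    congr 1
    · simp
    · field_simp
  rw [e1, ← sp (fun x => v x ^ 2) (k0.pow 2)]
  refine le_trans ?_ (mul_le_mul_of_nonneg_left e2 (sq_nonneg _))
  rw [← sp (fun x => deriv v x ^ 2) (k1.pow 2), Finset.mul_sum]
  refine Finset.sum_le_sum fun k hk => ?_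
  have := poinc hv (α := a + k * (L / p)) (β := a + (k + 1 : ℕ) * (L / p))
    (by push_cast; nlinarith) (hg k (Finset.mem_range.1 hk))
  refine this.trans (le_of_eq ?_)
  congr 2
  push_cast; ring

lemma int_ibp {u v : ℝ → ℝ} (hu : ContDiff ℝ 2 u) (hv : ContDiff ℝ 2 v) (hc : HasCompactSupport u) :
    ∫ x, (u x * deriv (deriv v) x + deriv u x * deriv v x) = 0 := by
  have k0 := c2_cont hv
  have k1 := c2_cont' hv
  have k2 := c2_cont'' hv
  have l0 := c2_cont hu
  have l1 := c2_cont' hu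
  refine integral_eq_zero_of_hasDerivAt_of_integrable (f := fun x => u x * deriv v x) ?_ ?_ ?_
  · intro x
    refine ((c2_diff hu x).hasDerivAt.mul (c2_diff' hv x).hasDerivAt).congr_deriv ?_
    ring
  · exact int_cs (by fun_prop) ((hc.mul_right).add (hc.deriv.mul_right))
  · exact int_cs (by fun_prop) hc.mul_right

lemma near_orth {Q : ℝ → ℝ} (hQ : Continuous Q) {u v : ℝ → ℝ} (hu : ContDiff ℝ 2 u) (hv : ContDiff ℝ 2 v)
    (hcu : HasCompactSupport u) (hcv : HasCompactSupport v) {e d η : ℝ} (hη : 0 < η)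
    (u1 : ∫ x, u x ^ 2 = 1) (v1 : ∫ x, v x ^ 2 = 1)
    (hue : ∫ x, (-deriv (deriv u) x + (Q x - e) * u x) ^ 2 ≤ η ^ 2)
    (hvd : ∫ x, (-deriv (deriv v) x + (Q x - d) * v x) ^ 2 ≤ η ^ 2) :
    |(e - d) * ∫ x, u x * v x| ≤ 2 * η := by
  have ku := c2_cont hu
  have kv := c2_cont hv
  have ku2 := c2_cont'' hu
  have kv2 := c2_cont'' hv
  have ku1 := c2_cont' hu
  have kv1 := c2_cont' hv
  have I1 := int_ibp hu hv hcu
  have I2 := int_ibp hv hu hcv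
  have iu : Integrable (fun x => u x ^ 2) := int_sq ku hcu
  have iv : Integrable (fun x => v x ^ 2) := int_sq kv hcv
  have iru : Integrable (fun x => (-deriv (deriv u) x + (Q x - e) * u x) ^ 2) :=
    int_op (by fun_prop) hu hcu
  have irv : Integrable (fun x => (-deriv (deriv v) x + (Q x - d) * v x) ^ 2) :=
    int_op (by fun_prop) hv hcv
  have iuv : Integrable (fun x => u x * v x) := int_cs (by fun_prop) hcu.mul_right
  have iA : Integrable (fun x => u x * deriv (deriv v) x + deriv u x * deriv v x) :=
    int_cs (by fun_prop) ((hcu.mul_right).add (hcu.deriv.mul_right))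
  have iB : Integrable (fun x => v x * deriv (deriv u) x + deriv v x * deriv u x) :=
    int_cs (by fun_prop) ((hcv.mul_right).add (hcv.deriv.mul_right))
  set ru := fun x => -deriv (deriv u) x + (Q x - e) * u x with hru
  set rv := fun x => -deriv (deriv v) x + (Q x - d) * v x with hrv
  have E : (e - d) * ∫ x, u x * v x = ∫ x, (u x * rv x - v x * ru x) := by
    have : ∀ x, u x * rv x - v x * ru x = (e - d) * (u x * v x)
      - (u x * deriv (deriv v) x + deriv u x * deriv v x)
      + (v x * deriv (deriv u) x + deriv v x * deriv u x) := fun x => by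
        simp only [hru, hrv]; ring
    simp only [this]
    have iC : Integrable (fun x => (e - d) * (u x * v x)) := iuv.const_mul _
    have iCA : Integrable (fun x => (e - d) * (u x * v x) -
      (u x * deriv (deriv v) x + deriv u x * deriv v x)) := iC.sub iA
    rw [integral_add iCA iB, integral_sub iC iA, I1, I2, integral_const_mul]
    ring
  have iS : Integrable (fun x => (ru x ^ 2 + rv x ^ 2) / (2 * η) + η / 2 * (u x ^ 2 + v x ^ 2)) :=
    ((iru.add irv).div_const _).add ((iu.add iv).const_mul _)
  have S : ∫ x, ((ru x ^ 2 + rv x ^ 2) / (2 * η) + η / 2 * (u x ^ 2 + v x ^ 2)) ≤ 2 * η := by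
    have j1 : Integrable (fun x => (ru x ^ 2 + rv x ^ 2) / (2 * η)) := (iru.add irv).div_const _
    have j2 : Integrable (fun x => η / 2 * (u x ^ 2 + v x ^ 2)) := (iu.add iv).const_mul _
    rw [integral_add j1 j2, integral_div,
      integral_const_mul, integral_add iru irv, integral_add iu iv, u1, v1]
    have : ((∫ x, ru x ^ 2) + ∫ x, rv x ^ 2) / (2 * η) ≤ η := by
      rw [div_le_iff₀ (by positivity)]; nlinarith
    linarith
  have am : ∀ r w : ℝ, |r * w| ≤ w ^ 2 / (2 * η) + η / 2 * r ^ 2 := by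
    intro r w
    have : w ^ 2 / (2 * η) + η / 2 * r ^ 2 = (w ^ 2 + η ^ 2 * r ^ 2) / (2 * η) := by
      field_simp
    rw [this, le_div_iff₀ (by positivity), abs_mul]
    nlinarith [sq_nonneg (|w| - η * |r|), sq_abs w, sq_abs r]
  rw [E]
  refine (abs_integral_le_integral_abs).trans (le_trans ?_ S)
  refine integral_mono_of_nonneg (Eventually.of_forall fun x => abs_nonneg _) iS
    (Eventually.of_forall fun x => ?_)
  refine (abs_sub _ _).trans ?_
  have a1 := am (u x) (rv x); have a2 := am (v x) (ru x)
  calc _ ≤ _ := add_le_add a1 a2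
    _ = _ := by ring

lemma counting {Q : ℝ → ℝ} (hQ : Continuous Q) {B R L η a : ℝ} (hQB : ∀ x, |Q x| ≤ B)
    (hL : 0 < L) (hη : 0 < η) (hη1 : η ≤ 1) {p : ℕ} (hp : 1 ≤ p)
    (hpL : L ^ 2 * (1 / 2 + B + 2 * (p + 1) * (1 + R ^ 2)) < p ^ 2) :
    volume {E : ℝ | E ∈ Icc (-R) R ∧ ¬ Res (Ioo a (a + L)) (fun x => Q x - E) (η ^ 2)} ≤
      ENNReal.ofReal (8 * (p + 1) ^ 2 * η) := by
  by_contra hcon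
  push Not at hcon
  have hp0 : (0 : ℝ) < p := by exact_mod_cast hp
  set s := 4 * ((p : ℝ) + 1) * η with hs
  have hs0 : 0 < s := by positivity
  obtain ⟨e0, he1, he2⟩ := separated hs0 p (lt_of_le_of_lt (ENNReal.ofReal_le_ofReal (by
    rw [hs]; nlinarith [mul_pos hp0 hη])) hcon) (p + 1) le_rfl
  -- quasimodes
  have qm : ∀ i : Fin (p + 1), ∃ v : ℝ → ℝ, ContDiff ℝ 2 v ∧ HasCompactSupport v ∧
      (∀ x, x ∉ Ioo a (a + L) → v x = 0) ∧ ∫ x, v x ^ 2 = 1 ∧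
      ∫ x, (-deriv (deriv v) x + (Q x - e0 i) * v x) ^ 2 ≤ η ^ 2 := by
    intro i
    obtain ⟨-, h⟩ := he1 i i.2
    simp only [Res, not_forall, not_le] at h
    obtain ⟨u, h1, h2, h3, h4⟩ := h
    have hpos : 0 < ∫ x, u x ^ 2 := by
      by_contra hn
      have : 0 ≤ ∫ x, u x ^ 2 := integral_nonneg fun x => sq_nonneg _
      have h0 : ∫ x, u x ^ 2 = 0 := by linarith
      rw [h0, mul_zero] at h4
      exact absurd h4 (not_lt.2 (integral_nonneg fun x => sq_nonneg _))
    set I := ∫ x, u x ^ 2 with hI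
    have hsq : (Real.sqrt I)⁻¹ ^ 2 = I⁻¹ := by rw [inv_pow, Real.sq_sqrt hpos.le]
    set k := (Real.sqrt I)⁻¹ with hk
    refine ⟨fun x => k * u x, contDiff_const.mul h1, h2.mul_left, fun x hx => by simp [h3 x hx], ?_, ?_⟩
    · simp only [mul_pow]
      rw [integral_const_mul, hsq, ← hI, inv_mul_cancel₀ hpos.ne']
    · have d1 : deriv (fun x => k * u x) = fun x => k * deriv u x := by
        funext x; exact ((c2_diff h1 x).hasDerivAt.const_mul k).deriv
      have d2 : deriv (deriv (fun x => k * u x)) = fun x => k * deriv (deriv u) x := by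
        rw [d1]; funext x; exact ((c2_diff' h1 x).hasDerivAt.const_mul k).deriv
      rw [d2]
      have : ∀ x, (-(k * deriv (deriv u) x) + (Q x - e0 i) * (k * u x)) ^ 2 =
        k ^ 2 * (-deriv (deriv u) x + (Q x - e0 i) * u x) ^ 2 := fun x => by ring
      simp only [this]
      rw [integral_const_mul, hsq, inv_mul_le_iff₀ hpos]
      linarith
  choose v v1 v2 v3 v4 v5 using qm
  -- linear dependence
  obtain ⟨c, hc0, hcg⟩ : ∃ c : Fin (p + 1) → ℝ, c ≠ 0 ∧ ∀ k : Fin p,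
      ∑ i, c i * v i (a + k * (L / p)) = 0 := by
    have := LinearMap.ker_ne_bot_of_finrank_lt
      (f := Matrix.mulVecLin (Matrix.of fun (k : Fin p) (i : Fin (p + 1)) => v i (a + k * (L / p))))
      (by simp)
    obtain ⟨c, hc, hc0⟩ := Submodule.exists_mem_ne_zero_of_ne_bot this
    refine ⟨c, hc0, fun k => ?_⟩
    have h := congrFun (LinearMap.mem_ker.1 hc) k
    simp only [Matrix.mulVecLin_apply, Matrix.mulVec, dotProduct, Matrix.of_apply, Pi.zero_apply] at h
    rw [← h]
    exact Finset.sum_congr rfl fun i _ => mul_comm _ _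
  set N := ∑ i, c i ^ 2 with hN
  have hN0 : 0 < N := by
    obtain ⟨i, hi⟩ := Function.ne_iff.1 hc0
    have : 0 < c i ^ 2 := by have : c i ≠ 0 := hi; positivity
    exact lt_of_lt_of_le this (Finset.single_le_sum (f := fun i => c i ^ 2) (fun i _ => sq_nonneg _) (Finset.mem_univ i))
  set w : ℝ → ℝ := fun x => ∑ i, c i * v i x with hw
  have w1 : ContDiff ℝ 2 w := ContDiff.sum fun i _ => contDiff_const.mul (v1 i)
  have w3 : ∀ x, x ∉ Ioo a (a + L) → w x = 0 := fun x hx => by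
    simp only [hw]; exact Finset.sum_eq_zero fun i _ => by rw [v3 i x hx, mul_zero]
  have w2 : HasCompactSupport w := HasCompactSupport.intro (isCompact_Icc (a := a) (b := a + L))
    fun x hx => w3 x fun h => hx ⟨h.1.le, h.2.le⟩
  have dw : deriv w = fun x => ∑ i, c i * deriv (v i) x := by
    funext x
    exact (HasDerivAt.fun_sum fun i _ => (c2_diff (v1 i) x).hasDerivAt.const_mul (c i)).deriv
  have ddw : deriv (deriv w) = fun x => ∑ i, c i * deriv (deriv (v i)) x := by
    rw [dw]; funext x
    exact (HasDerivAt.fun_sum fun i _ => (c2_diff' (v1 i) x).hasDerivAt.const_mul (c i)).deriv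
  have kv : ∀ i, Continuous (v i) := fun i => c2_cont (v1 i)
  have kv2 : ∀ i, Continuous (deriv (deriv (v i))) := fun i => c2_cont'' (v1 i)
  have ivv : ∀ i j, Integrable (fun x => v i x * v j x) := fun i j =>
    int_cs ((kv i).mul (kv j)) (v2 i).mul_right
  set θ := 1 / (2 * ((p : ℝ) + 1)) with hθ
  have orth : ∀ i j, i ≠ j → |∫ x, v i x * v j x| ≤ θ := by
    intro i j hij
    have h1 := near_orth hQ (v1 i) (v1 j) (v2 i) (v2 j) hη (v4 i) (v4 j) (v5 i) (v5 j)
    have h2 := he2 i i.2 j j.2 (fun h => hij (Fin.ext h))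
    rw [abs_mul] at h1
    have h3 := (mul_le_mul_of_nonneg_right h2 (abs_nonneg (∫ x, v i x * v j x))).trans h1
    rw [hθ, le_div_iff₀ (by positivity)]
    rw [hs] at h3
    have : η * (4 * (p + 1) * |∫ x, v i x * v j x|) ≤ η * 2 := by linarith
    have := le_of_mul_le_mul_left this hη
    linarith
  have W1 : ∫ x, w x ^ 2 = ∑ i, ∑ j, c i * c j * ∫ x, v i x * v j x := by
    have : ∀ x, w x ^ 2 = ∑ i, ∑ j, c i * c j * (v i x * v j x) := by
      intro x
      simp only [hw]
      rw [sq, Finset.sum_mul_sum]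
      exact Finset.sum_congr rfl fun i _ => Finset.sum_congr rfl fun j _ => by ring
    simp only [this]
    rw [integral_finset_sum _ fun i _ => integrable_finset_sum _ fun j _ => (ivv i j).const_mul _]
    refine Finset.sum_congr rfl fun i _ => ?_
    rw [integral_finset_sum _ fun j _ => (ivv i j).const_mul _]
    exact Finset.sum_congr rfl fun j _ => integral_const_mul _ _
  have W2 : N / 2 ≤ ∫ x, w x ^ 2 := by
    rw [W1]
    have t : ∀ i j, (if i = j then c i ^ 2 else 0) - θ * (|c i| * |c j|) ≤ c i * c j * ∫ x, v i x * v j x := by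
      intro i j
      have hθ0 : 0 < θ := by positivity
      by_cases hij : i = j
      · subst hij
        have : ∫ x, v i x * v i x = 1 := by rw [← v4 i]; congr 1; funext x; ring
        rw [this, if_pos rfl]
        have := mul_nonneg hθ0.le (mul_nonneg (abs_nonneg (c i)) (abs_nonneg (c i)))
        nlinarith
      · rw [if_neg hij]
        have h1 := orth i j hij
        have h2 : |c i * c j * ∫ x, v i x * v j x| ≤ θ * (|c i| * |c j|) := by
          rw [abs_mul, abs_mul, mul_comm]
          exact mul_le_mul_of_nonneg_right h1 (by positivity)
        have := neg_le_of_abs_le h2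
        linarith
    refine le_trans ?_ (Finset.sum_le_sum fun i _ => Finset.sum_le_sum fun j _ => t i j)
    simp only [Finset.sum_sub_distrib, Finset.sum_ite_eq, Finset.mem_univ, if_true, ← Finset.mul_sum,
      ← Finset.sum_mul]
    have h1 := sq_sum_le_card_mul_sum_sq (s := (Finset.univ : Finset (Fin (p + 1)))) (f := fun i => |c i|)
    simp only [sq_abs, Finset.card_univ, Fintype.card_fin] at h1
    rw [← hN] at h1 ⊢
    push_cast at h1
    have h2 : θ * ((∑ i, |c i|) * ∑ i, |c i|) ≤ N / 2 := by
      rw [hθ, one_div, inv_mul_le_iff₀ (by positivity)]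
      nlinarith
    linarith
  set Hw := fun x => -deriv (deriv w) x + Q x * w x with hHw
  have iHw : Integrable (fun x => Hw x ^ 2) := int_op hQ w1 w2
  have kw := c2_cont w1
  have kw1 := c2_cont' w1
  have kw2 := c2_cont'' w1
  have iw : Integrable (fun x => w x ^ 2) := int_sq kw w2
  have W3 : ∫ x, Hw x ^ 2 ≤ N * ((p + 1) * (2 + 2 * R ^ 2)) := by
    have ir : ∀ i, Integrable (fun x => (-deriv (deriv (v i)) x + (Q x - e0 i) * v i x) ^ 2) :=
      fun i => int_op (by fun_prop) (v1 i) (v2 i)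
    have iv : ∀ i, Integrable (fun x => v i x ^ 2) := fun i => int_sq (kv i) (v2 i)
    have pt : ∀ x, Hw x ^ 2 ≤ N * ∑ i, (2 * (-deriv (deriv (v i)) x + (Q x - e0 i) * v i x) ^ 2
        + 2 * R ^ 2 * v i x ^ 2) := by
      intro x
      have : Hw x = ∑ i, c i * ((-deriv (deriv (v i)) x + (Q x - e0 i) * v i x) + e0 i * v i x) := by
        simp only [hHw]
        rw [congrFun ddw x]
        simp only [hw]
        rw [Finset.mul_sum, ← Finset.sum_neg_distrib, ← Finset.sum_add_distrib]
        exact Finset.sum_congr rfl fun i _ => by ring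
      rw [this]
      refine (Finset.sum_mul_sq_le_sq_mul_sq _ _ _).trans ?_
      refine mul_le_mul_of_nonneg_left (Finset.sum_le_sum fun i _ => ?_) hN0.le
      have h1 := (he1 i i.2).1
      have h2 : e0 i ^ 2 ≤ R ^ 2 := sq_le_sq' h1.1 h1.2
      have h3 := mul_le_mul_of_nonneg_right h2 (sq_nonneg (v i x))
      nlinarith [sq_nonneg (-deriv (deriv (v i)) x + (Q x - e0 i) * v i x - e0 i * v i x)]
    have iT : ∀ i, Integrable (fun x => 2 * (-deriv (deriv (v i)) x + (Q x - e0 i) * v i x) ^ 2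
        + 2 * R ^ 2 * v i x ^ 2) := fun i => ((ir i).const_mul _).add ((iv i).const_mul _)
    refine (integral_mono iHw ((integrable_finset_sum _ fun i _ => iT i).const_mul N) pt).trans ?_
    rw [integral_const_mul, integral_finset_sum _ fun i _ => iT i]
    refine mul_le_mul_of_nonneg_left ?_ hN0.le
    have : ∀ i ∈ (Finset.univ : Finset (Fin (p + 1))), ∫ x, (2 * (-deriv (deriv (v i)) x + (Q x - e0 i) * v i x) ^ 2
        + 2 * R ^ 2 * v i x ^ 2) ≤ 2 + 2 * R ^ 2 := by
      intro i _
      rw [integral_add ((ir i).const_mul _) ((iv i).const_mul _), integral_const_mul, integral_const_mul,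
        v4 i]
      have := v5 i
      have : η ^ 2 ≤ 1 := by nlinarith
      linarith
    refine (Finset.sum_le_sum this).trans (le_of_eq ?_)
    simp
    ring
  have W4 : ∫ x, deriv w x ^ 2 ≤ (1 / 2 + B) * (∫ x, w x ^ 2) + 1 / 2 * ∫ x, Hw x ^ 2 := by
    have I := int_ibp w1 w1 w2
    have iA : Integrable (fun x => w x * deriv (deriv w) x + deriv w x * deriv w x) :=
      int_cs (by fun_prop) ((w2.mul_right).add (w2.deriv.mul_right))
    have iD : Integrable (fun x => deriv w x ^ 2) := int_sq kw1 w2.deriv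
    rw [← integral_const_mul, ← integral_const_mul, ← integral_add (iw.const_mul _) (iHw.const_mul _)]
    have : ∫ x, deriv w x ^ 2 = ∫ x, (deriv w x ^ 2 - (w x * deriv (deriv w) x + deriv w x * deriv w x)) := by
      rw [integral_sub iD iA, I, sub_zero]
    rw [this]
    refine integral_mono (iD.sub iA) ((iw.const_mul _).add (iHw.const_mul _)) fun x => ?_
    beta_reduce
    have h1 := neg_le_of_abs_le (hQB x)
    have h2 := mul_nonneg (by linarith : 0 ≤ B + Q x) (sq_nonneg (w x))
    have h3 : deriv (deriv w) x = Q x * w x - Hw x := by simp only [hHw]; ring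
    rw [h3]
    nlinarith [sq_nonneg (w x - Hw x)]
  have W5 := poinc_grid w1 w2 hL hp w3 fun k hk => hcg ⟨k, hk⟩
  have hpos : 0 < ∫ x, w x ^ 2 := by linarith
  set J := ∫ x, w x ^ 2 with hJ
  set D := 1 / 2 + B + 2 * ((p : ℝ) + 1) * (1 + R ^ 2) with hD
  have W6 : ∫ x, deriv w x ^ 2 ≤ D * J := by
    have : N * ((p + 1) * (2 + 2 * R ^ 2)) ≤ 2 * J * ((p + 1) * (2 + 2 * R ^ 2)) :=
      mul_le_mul_of_nonneg_right (by linarith) (by positivity)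
    rw [hD]; linarith
  have W7 : J ≤ (L / p) ^ 2 * (D * J) := W5.trans (mul_le_mul_of_nonneg_left W6 (sq_nonneg _))
  have W8 : (L / p) ^ 2 * D < 1 := by
    rw [div_pow, div_mul_eq_mul_div, div_lt_one (by positivity)]; exact hpL
  nlinarith


lemma rep {T : ℝ} (hT : 0 < T) (x : ℝ) : ∃ (n : ℤ) (t : ℝ), 0 ≤ t ∧ t < T ∧ x = n * T + t := by
  refine ⟨⌊x / T⌋, x - ⌊x / T⌋ * T, ?_, ?_, by ring⟩
  · have := Int.floor_le (x / T)
    rw [le_div_iff₀ hT] at this; linarith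
  · have := Int.lt_floor_add_one (x / T)
    rw [div_lt_iff₀ hT] at this; linarith

lemma concat_fun {T : ℝ} (hT : 0 < T) (g : ℤ → ℝ → ℝ) (hc : ∀ n, ContinuousOn (g n) (Icc 0 T))
    (h0 : ∀ n, g n 0 = 0) (hT0 : ∀ n, g n T = 0) {ε : ℝ} (hb : ∀ n, ∀ t ∈ Icc 0 T, |g n t| ≤ ε) :
    ∃ G : ℝ → ℝ, Continuous G ∧ (∀ (n : ℤ), ∀ t ∈ Icc 0 T, G (n * T + t) = g n t) ∧
      ∀ x, |G x| ≤ ε := by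
  set G : ℝ → ℝ := fun x => g ⌊x / T⌋ (x - ⌊x / T⌋ * T) with hG
  have val : ∀ (n : ℤ), ∀ t ∈ Icc 0 T, G (n * T + t) = g n t := by
    intro n t ht
    rcases eq_or_lt_of_le ht.2 with rfl | hlt
    · have : ⌊((n : ℝ) * t + t) / t⌋ = n + 1 := by
        rw [Int.floor_eq_iff]; rw [add_div, mul_div_cancel_right₀ _ hT.ne', div_self hT.ne']
        push_cast; constructor <;> linarith
      simp only [hG, this]
      push_cast
      rw [hT0, ← h0 (n + 1)]
      congr 1; ring
    · have : ⌊((n : ℝ) * T + t) / T⌋ = n := by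
        rw [Int.floor_eq_iff]; rw [add_div, mul_div_cancel_right₀ _ hT.ne']
        have h1 : 0 ≤ t / T := div_nonneg ht.1 hT.le
        have h2 : t / T < 1 := (div_lt_one hT).2 hlt
        constructor <;> linarith
      simp only [hG, this]
      congr 1; ring
  have con : ∀ n : ℤ, ContinuousOn G (Icc (n * T) ((n + 1) * T)) := by
    intro n
    have h1 : ContinuousOn (fun x => g n (x - n * T)) (Icc (n * T) ((n + 1) * T)) := by
      refine (hc n).comp (by fun_prop) ?_
      intro x hx
      exact ⟨by linarith [hx.1], by linarith [hx.2]⟩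
    refine h1.congr ?_
    intro x hx
    have := val n (x - n * T) ⟨by linarith [hx.1], by linarith [hx.2]⟩
    rwa [add_sub_cancel] at this
  refine ⟨G, ?_, val, ?_⟩
  · rw [continuous_iff_continuousAt]
    intro x
    obtain ⟨n, t, h1, h2, rfl⟩ := rep hT x
    have h := (con (n - 1)).union_of_isClosed (con n) isClosed_Icc isClosed_Icc
    push_cast at h
    rw [sub_add_cancel, Icc_union_Icc_eq_Icc (by linarith) (by linarith)] at h
    exact h.continuousAt (Icc_mem_nhds (by linarith) (by linarith))
  · intro x
    obtain ⟨n, t, h1, h2, rfl⟩ := rep hT x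
    rw [val n t ⟨h1, h2.le⟩]
    exact hb n t ⟨h1, h2.le⟩


def clampR (R x : ℝ) : ℝ := max (-R) (min R x)

lemma clampR_lip (R x y : ℝ) : |clampR R x - clampR R y| ≤ |x - y| := by
  unfold clampR
  refine (abs_max_sub_max_le_max _ _ _ _).trans ?_
  rw [sub_self, abs_zero, max_eq_right (abs_nonneg _)]
  refine (abs_min_sub_min_le_max _ _ _ _).trans ?_
  rw [sub_self, abs_zero, max_eq_right (abs_nonneg _)]

lemma clampR_le {R : ℝ} (hR : 0 ≤ R) (x : ℝ) : |clampR R x| ≤ R := by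
  unfold clampR
  rw [abs_le]
  exact ⟨le_max_left _ _, max_le (by linarith) (min_le_left _ _)⟩

lemma clampR_eq {R x : ℝ} (h : |x| ≤ R) : clampR R x = x := by
  unfold clampR
  obtain ⟨h1, h2⟩ := abs_le.1 h
  rw [min_eq_right h2, max_eq_right h1]

lemma clampR_le' {R : ℝ} (hR : 0 ≤ R) (x : ℝ) : |clampR R x| ≤ |x| := by
  have h := clampR_lip R x 0
  rwa [clampR_eq (x := 0) (by simpa using hR), sub_zero, sub_zero] at h

lemma lin_ode {q : ℝ → ℝ} (hq : Continuous q) {B : ℝ} (hB1 : 1 ≤ B) (hB : ∀ x, |q x| ≤ B) {T : ℝ}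
    (hT : 0 < T) (x0 y0 : ℝ) : ∃ U U' : ℝ → ℝ, Continuous U ∧ Continuous U' ∧ U 0 = x0 ∧ U' 0 = y0 ∧
      ∀ t ∈ Ioo 0 T, HasDerivAt U (U' t) t ∧ HasDerivAt U' (q t * U t) t := by
  set R : ℝ := ‖(x0, y0)‖ * Real.exp (B * T) with hR
  have hR0 : 0 ≤ R := by positivity
  set f : ℝ → ℝ × ℝ → ℝ × ℝ := fun t z => (clampR R z.2, q t * clampR R z.1) with hf
  have hB0 : 0 ≤ B := by linarith
  have pl : IsPicardLindelof f (tmin := 0) (tmax := T) ⟨0, le_rfl, hT.le⟩ (x0, y0)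
      (a := ⟨B * R * T, by positivity⟩) (r := 0) (L := ⟨B * R, by positivity⟩) (K := ⟨B, hB0⟩) := by
    constructor
    · intro t _
      refine LipschitzOnWith.of_dist_le_mul fun z _ w _ => ?_
      simp only [hf, Prod.dist_eq, Real.dist_eq]
      refine max_le ?_ ?_
      · refine (clampR_lip R _ _).trans ((le_max_right _ _).trans (le_mul_of_one_le_left ?_ hB1))
        exact le_max_of_le_left (abs_nonneg _)
      · rw [← mul_sub, abs_mul]
        exact mul_le_mul (hB t) ((clampR_lip R _ _).trans (le_max_left _ _)) (abs_nonneg _) hB0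
    · intro z _
      exact Continuous.continuousOn (by fun_prop)
    · intro t _ z _
      simp only [hf, Prod.norm_def, Real.norm_eq_abs]
      refine max_le ((clampR_le hR0 _).trans (le_mul_of_one_le_left hR0 hB1)) ?_
      rw [abs_mul]
      exact mul_le_mul (hB t) (clampR_le hR0 _) (abs_nonneg _) hB0
    · simp only [sub_zero, max_eq_left hT.le, NNReal.coe_zero]
      exact le_rfl
  obtain ⟨z, hz0, hz⟩ := pl.exists_eq_forall_mem_Icc_hasDerivWithinAt₀
  have zc : ContinuousOn z (Icc 0 T) := fun t ht => (hz t ht).continuousWithinAt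
  have zb : ∀ t ∈ Icc 0 T, ‖z t‖ ≤ R := by
    intro t ht
    have := norm_le_gronwallBound_of_norm_deriv_right_le (f' := fun t => f t (z t)) (K := B) (ε := 0)
      (δ := ‖(x0, y0)‖) zc (fun x hx => ?_) (le_of_eq (by rw [← hz0])) (fun x hx => ?_) t ht
    · rw [gronwallBound_ε0] at this
      refine this.trans ?_
      rw [hR]
      refine mul_le_mul_of_nonneg_left (Real.exp_le_exp.2 ?_) (norm_nonneg _)
      exact mul_le_mul_of_nonneg_left (by linarith [ht.2]) hB0
    · exact (hz x ⟨hx.1, hx.2.le⟩).mono_of_mem_nhdsWithin (Icc_mem_nhdsGE_of_mem hx)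
    · simp only [hf, Prod.norm_def, Real.norm_eq_abs, add_zero]
      refine max_le ?_ ?_
      · refine (clampR_le' hR0 _).trans ((le_max_right _ _).trans (le_mul_of_one_le_left ?_ hB1))
        exact le_max_of_le_left (abs_nonneg _)
      · rw [abs_mul]
        exact mul_le_mul (hB x) ((clampR_le' hR0 _).trans (le_max_left _ _)) (abs_nonneg _) hB0
  have hz' : ∀ t ∈ Ioo 0 T, HasDerivAt z ((z t).2, q t * (z t).1) t := by
    intro t ht
    have ht' : t ∈ Icc 0 T := ⟨ht.1.le, ht.2.le⟩
    have h := (hz t ht').hasDerivAt (Icc_mem_nhds ht.1 ht.2)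
    have hb := zb t ht'
    rw [Prod.norm_def] at hb
    simp only [hf] at h
    rwa [clampR_eq ((le_max_left _ _).trans hb), clampR_eq ((le_max_right _ _).trans hb)] at h
  set Z : ℝ → ℝ × ℝ := IccExtend hT.le ((Icc 0 T).domRestrict z) with hZ
  have Zc : Continuous Z := zc.domRestrict.Icc_extend'
  have Ze : ∀ t ∈ Icc 0 T, Z t = z t := fun t ht => by
    rw [hZ, IccExtend_of_mem hT.le _ ht]; rfl
  have Z0 : Z 0 = (x0, y0) := by rw [Ze 0 ⟨le_rfl, hT.le⟩]; exact hz0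
  have Zd : ∀ t ∈ Ioo 0 T, HasDerivAt Z ((Z t).2, q t * (Z t).1) t := by
    intro t ht
    rw [Ze t ⟨ht.1.le, ht.2.le⟩]
    refine (hz' t ht).congr_of_eventuallyEq ?_
    filter_upwards [Icc_mem_nhds ht.1 ht.2] with s hs using Ze s hs
  refine ⟨fun t => (Z t).1, fun t => (Z t).2, by fun_prop, by fun_prop, by simp [Z0], by simp [Z0], ?_⟩
  intro t ht
  have h1 := (hasFDerivAt_fst (𝕜 := ℝ) (p := Z t)).comp_hasDerivAt t (Zd t ht)
  have h2 := (hasFDerivAt_snd (𝕜 := ℝ) (p := Z t)).comp_hasDerivAt t (Zd t ht)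
  exact ⟨h1, h2⟩

/-- a fundamental system on `[0,T]` -/
structure Fund (q : ℝ → ℝ) (T : ℝ) (u v u' v' : ℝ → ℝ) : Prop where
  cu : Continuous u
  cv : Continuous v
  cu' : Continuous u'
  cv' : Continuous v'
  u0 : u 0 = 1
  u'0 : u' 0 = 0
  v0 : v 0 = 0
  v'0 : v' 0 = 1
  du : ∀ t ∈ Ioo 0 T, HasDerivAt u (u' t) t
  dv : ∀ t ∈ Ioo 0 T, HasDerivAt v (v' t) t
  du' : ∀ t ∈ Ioo 0 T, HasDerivAt u' (q t * u t) t
  dv' : ∀ t ∈ Ioo 0 T, HasDerivAt v' (q t * v t) t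
  wr : ∀ t ∈ Icc 0 T, u t * v' t - u' t * v t = 1

lemma exists_fund {q : ℝ → ℝ} (hq : Continuous q) {B : ℝ} (hB1 : 1 ≤ B) (hB : ∀ x, |q x| ≤ B) {T : ℝ}
    (hT : 0 < T) : ∃ u v u' v', Fund q T u v u' v' := by
  obtain ⟨u, u', a1, a2, a3, a4, a5⟩ := lin_ode hq hB1 hB hT 1 0
  obtain ⟨v, v', b1, b2, b3, b4, b5⟩ := lin_ode hq hB1 hB hT 0 1
  refine ⟨u, v, u', v', a1, b1, a2, b2, a3, a4, b3, b4, fun t ht => (a5 t ht).1, fun t ht => (b5 t ht).1,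
    fun t ht => (a5 t ht).2, fun t ht => (b5 t ht).2, ?_⟩
  intro t ht
  have key : ∫ s in (0:ℝ)..t, (0 : ℝ) = (u t * v' t - u' t * v t) - (u 0 * v' 0 - u' 0 * v 0) := by
    refine intervalIntegral.integral_eq_sub_of_hasDerivAt_of_le (f := fun s => u s * v' s - u' s * v s)
      ht.1 (Continuous.continuousOn (by fun_prop)) ?_ (by simp)
    intro s hs
    have hs' : s ∈ Ioo 0 T := ⟨hs.1, hs.2.trans_le ht.2⟩
    refine (((a5 s hs').1.mul (b5 s hs').2).sub ((a5 s hs').2.mul (b5 s hs').1)).congr_deriv ?_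
    ring
  rw [a3, a4, b3, b4] at key
  simp at key
  linarith


lemma quad_indep {q : ℝ → ℝ} {T : ℝ} (hT : 0 < T) {u v u' v' : ℝ → ℝ} (h : Fund q T u v u' v')
    (x y z : ℝ) (h0 : ∀ t ∈ Ioo 0 T, x * u t ^ 2 + y * (u t * v t) + z * v t ^ 2 = 0) :
    x = 0 ∧ y = 0 ∧ z = 0 := by
  have nb : ∀ t ∈ Ioo 0 T, Ioo 0 T ∈ 𝓝 t := fun t ht => Ioo_mem_nhds ht.1 ht.2
  have dz : ∀ (f : ℝ → ℝ) (f' : ℝ) (t : ℝ), t ∈ Ioo 0 T → (∀ t ∈ Ioo 0 T, f t = 0) →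
      HasDerivAt f f' t → f' = 0 := by
    intro f f' t ht hf hd
    have : HasDerivAt f 0 t := (hasDerivAt_const t (0 : ℝ)).congr_of_eventuallyEq (by
      filter_upwards [nb t ht] with s hs using hf s hs)
    exact hd.unique this
  have h1 : ∀ t ∈ Ioo 0 T, x * (2 * u t * u' t) + y * (u' t * v t + u t * v' t) + z * (2 * v t * v' t) = 0 := by
    intro t ht
    refine dz _ _ t ht h0 ?_
    have := ((((h.du t ht).pow 2).const_mul x).add (((h.du t ht).mul (h.dv t ht)).const_mul y)).add
      (((h.dv t ht).pow 2).const_mul z)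
    refine this.congr_deriv ?_
    simp
  have h2 : ∀ t ∈ Ioo 0 T, x * (2 * (u' t * u' t + u t * (q t * u t))) +
      y * ((q t * u t * v t + u' t * v' t) + (u' t * v' t + u t * (q t * v t))) +
      z * (2 * (v' t * v' t + v t * (q t * v t))) = 0 := by
    intro t ht
    refine dz _ _ t ht h1 ?_
    have hu := h.du t ht; have hv := h.dv t ht; have hu' := h.du' t ht; have hv' := h.dv' t ht
    have := ((((hu.const_mul 2).mul hu').const_mul x).add (((hu'.mul hv).add (hu.mul hv')).const_mul y)).add
      (((hv.const_mul 2).mul hv').const_mul z)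
    refine this.congr_deriv ?_
    ring
  have ht : T / 2 ∈ Ioo 0 T := ⟨by linarith, by linarith⟩
  have e0 := h0 _ ht
  have e1 := h1 _ ht
  have e2 := h2 _ ht
  have w := h.wr _ ⟨ht.1.le, ht.2.le⟩
  set a := u (T / 2); set b := v (T / 2); set c := u' (T / 2); set d := v' (T / 2)
  set Q := q (T / 2)
  have e3 : x * c ^ 2 + y * (c * d) + z * d ^ 2 = 0 := by linear_combination e2 / 2 - Q * e0
  -- X = form; inverse transformation
  have wx : (a * d - c * b) ^ 2 = 1 := by rw [w]; norm_num
  refine ⟨?_, ?_, ?_⟩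
  · have : x * (a * d - c * b) ^ 2 = 0 := by
      linear_combination d ^ 2 * e0 - d * b * e1 + b ^ 2 * e3
    rwa [wx, mul_one] at this
  · have : y * (a * d - c * b) ^ 2 = 0 := by
      linear_combination (-2 * c * d) * e0 + (a * d + b * c) * e1 - 2 * a * b * e3
    rwa [wx, mul_one] at this
  · have : z * (a * d - c * b) ^ 2 = 0 := by
      linear_combination c ^ 2 * e0 - a * c * e1 + a ^ 2 * e3
    rwa [wx, mul_one] at this

lemma gram {q : ℝ → ℝ} {T : ℝ} (hT : 0 < T) {u v u' v' : ℝ → ℝ} (h : Fund q T u v u' v') :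
    ∃ C : ℝ, 0 ≤ C ∧ ∀ s1 s2 s3 s : ℝ, |s1| ≤ s → |s2| ≤ s → |s3| ≤ s → ∃ w : ℝ → ℝ, Continuous w ∧
      w 0 = 0 ∧ w T = 0 ∧ (∀ t ∈ Icc 0 T, |w t| ≤ C * s) ∧ (∫ t in (0:ℝ)..T, w t * u t ^ 2) = s1 ∧
      (∫ t in (0:ℝ)..T, w t * (u t * v t)) = s2 ∧ (∫ t in (0:ℝ)..T, w t * v t ^ 2) = s3 := by
  have ku := h.cu
  have kv := h.cv
  set m : Fin 3 → ℝ → ℝ := ![fun t => u t ^ 2, fun t => u t * v t, fun t => v t ^ 2] with hm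
  have km : ∀ k, Continuous (m k) := by
    intro k; fin_cases k <;> simp [hm] <;> fun_prop
  set β : ℝ → ℝ := fun t => t * (T - t) with hβ
  have kβ : Continuous β := by fun_prop
  set G : Matrix (Fin 3) (Fin 3) ℝ := Matrix.of fun k j => ∫ t in (0:ℝ)..T, β t * m k t * m j t with hG
  have ii : ∀ f : ℝ → ℝ, Continuous f → IntervalIntegrable f volume 0 T :=
    fun f hf => hf.intervalIntegrable _ _
  have kS : ∀ x : Fin 3 → ℝ, Continuous (fun t => ∑ j, x j * m j t) := fun x =>
    continuous_finsetSum _ fun j _ => continuous_const.mul (km j)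
  have Gx : ∀ (x : Fin 3 → ℝ) k, (G.mulVec x) k = ∫ t in (0:ℝ)..T, (β t * ∑ j, x j * m j t) * m k t := by
    intro x k
    simp only [Matrix.mulVec, dotProduct, hG, Matrix.of_apply]
    have : ∀ t, (β t * ∑ j, x j * m j t) * m k t = ∑ j, x j * (β t * m k t * m j t) := by
      intro t
      rw [Finset.mul_sum, Finset.sum_mul]
      exact Finset.sum_congr rfl fun j _ => by ring
    simp only [this]
    have J : ∀ j ∈ Finset.univ, IntervalIntegrable (fun t => x j * (β t * m k t * m j t)) volume 0 T :=
      fun j _ => ii _ (continuous_const.mul ((kβ.mul (km k)).mul (km j)))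
    rw [intervalIntegral.integral_finsetSum J]
    refine Finset.sum_congr rfl fun j _ => ?_
    rw [intervalIntegral.integral_const_mul, mul_comm]
  have det : G.det ≠ 0 := by
    intro hdet
    obtain ⟨x, hx0, hx⟩ := Matrix.exists_mulVec_eq_zero_iff.2 hdet
    apply hx0
    have Z : ∫ t in (0:ℝ)..T, β t * (∑ j, x j * m j t) ^ 2 = 0 := by
      have : ∀ t, β t * (∑ j, x j * m j t) ^ 2 = ∑ k, x k * ((β t * ∑ j, x j * m j t) * m k t) := by
        intro t
        have : ∑ k, x k * ((β t * ∑ j, x j * m j t) * m k t) =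
          ∑ k, (β t * ∑ j, x j * m j t) * (x k * m k t) := Finset.sum_congr rfl fun k _ => by ring
        rw [this, ← Finset.mul_sum]; ring
      simp only [this]
      have J : ∀ k ∈ Finset.univ, IntervalIntegrable
          (fun t => x k * ((β t * ∑ j, x j * m j t) * m k t)) volume 0 T :=
        fun j _ => ii _ (continuous_const.mul ((kβ.mul (kS x)).mul (km j)))
      rw [intervalIntegral.integral_finsetSum J]
      refine Finset.sum_eq_zero fun k _ => ?_
      rw [intervalIntegral.integral_const_mul, ← Gx, hx]; simp
    have hz : ∀ t ∈ Ioo 0 T, ∑ j, x j * m j t = 0 := by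
      intro t ht
      by_contra hne
      have := intervalIntegral.integral_pos (f := fun t => β t * (∑ j, x j * m j t) ^ 2) hT
        (kβ.mul ((kS x).pow 2)).continuousOn
        (fun s hs => mul_nonneg (mul_nonneg hs.1.le (by linarith [hs.2])) (sq_nonneg _))
        ⟨t, ⟨ht.1.le, ht.2.le⟩, by
          have : 0 < β t := mul_pos ht.1 (by linarith [ht.2])
          positivity⟩
      exact this.ne' Z
    obtain ⟨i, j, k⟩ := quad_indep hT h (x 0) (x 1) (x 2) (fun t ht => by
      have := hz t ht
      rw [Fin.sum_univ_three] at this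
      simpa [hm] using this)
    funext l
    fin_cases l <;> simpa
  have hunit : IsUnit G.det := isUnit_iff_ne_zero.2 det
  have bd : ∀ f : ℝ → ℝ, Continuous f → ∃ C, 0 ≤ C ∧ ∀ t ∈ Icc 0 T, |f t| ≤ C := by
    intro f hf
    obtain ⟨C, hC⟩ := isCompact_Icc.exists_bound_of_continuousOn (hf.continuousOn (s := Icc 0 T))
    exact ⟨C, (norm_nonneg _).trans (hC 0 ⟨le_rfl, hT.le⟩), hC⟩
  choose Cm hCm0 hCm using fun k => bd (fun t => β t * m k t) (kβ.mul (km k))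
  refine ⟨∑ k, (∑ j, |G⁻¹ k j|) * Cm k, Finset.sum_nonneg fun k _ => mul_nonneg
    (Finset.sum_nonneg fun j _ => abs_nonneg _) (hCm0 k), ?_⟩
  intro s1 s2 s3 s h1 h2 h3
  have hs0 : 0 ≤ s := (abs_nonneg _).trans h1
  set S : Fin 3 → ℝ := ![s1, s2, s3] with hS
  have hSb : ∀ j, |S j| ≤ s := by intro j; fin_cases j <;> simpa [hS]
  set x := G⁻¹.mulVec S with hx
  have hGx : G.mulVec x = S := by
    rw [hx, Matrix.mulVec_mulVec, Matrix.mul_nonsing_inv _ hunit, Matrix.one_mulVec]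
  have I : ∀ k, ∫ t in (0:ℝ)..T, (β t * ∑ j, x j * m j t) * m k t = S k := fun k => by
    rw [← Gx, hGx]
  refine ⟨fun t => β t * ∑ j, x j * m j t, kβ.mul (kS x), by simp [hβ], by simp [hβ], ?_, ?_, ?_, ?_⟩
  · intro t ht
    show |β t * ∑ j, x j * m j t| ≤ _
    rw [Finset.mul_sum, Finset.sum_mul]
    refine (Finset.abs_sum_le_sum_abs _ _).trans (Finset.sum_le_sum fun k _ => ?_)
    have e : β t * (x k * m k t) = x k * (β t * m k t) := by ring
    rw [e, abs_mul]
    have xb : |x k| ≤ (∑ j, |G⁻¹ k j|) * s := by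
      rw [hx, Finset.sum_mul]
      simp only [Matrix.mulVec, dotProduct]
      refine (Finset.abs_sum_le_sum_abs _ _).trans (Finset.sum_le_sum fun j _ => ?_)
      rw [abs_mul]
      exact mul_le_mul_of_nonneg_left (hSb j) (abs_nonneg _)
    calc _ ≤ ((∑ j, |G⁻¹ k j|) * s) * Cm k := mul_le_mul xb (hCm k t ht) (abs_nonneg _)
          (mul_nonneg (Finset.sum_nonneg fun j _ => abs_nonneg _) hs0)
      _ = _ := by ring
  · simpa [hm, hS] using I 0
  · simpa [hm, hS] using I 1
  · simpa [hm, hS] using I 2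

lemma ell_bdd {p r s t : ℝ} (hd : p * t - r * s = 1) (ht : (p + t) ^ 2 < 4) (x y : ℕ → ℝ)
    (hx : ∀ n, x (n + 1) = p * x n + r * y n) (hy : ∀ n, y (n + 1) = s * x n + t * y n) :
    ∃ C, ∀ n, |x n| ≤ C ∧ |y n| ≤ C := by
  have inv : ∀ n, s * x n ^ 2 + (t - p) * (x n * y n) - r * y n ^ 2 =
      s * x 0 ^ 2 + (t - p) * (x 0 * y 0) - r * y 0 ^ 2 := by
    intro n
    induction n with
    | zero => rfl
    | succ n ih =>
      rw [← ih, hx, hy]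
      linear_combination (s * x n ^ 2 + (t - p) * (x n * y n) - r * y n ^ 2) * hd
  set Q := s * x 0 ^ 2 + (t - p) * (x 0 * y 0) - r * y 0 ^ 2
  set D := 4 - (p + t) ^ 2 with hD
  have hD0 : 0 < D := by linarith
  set C := (|4 * s * Q| + |4 * r * Q|) / D + 1 with hC
  have hb : ∀ z : ℝ, D * z ^ 2 ≤ |4 * s * Q| + |4 * r * Q| → |z| ≤ C := by
    intro z hz
    have h1 : z ^ 2 ≤ C := by
      have : z ^ 2 ≤ (|4 * s * Q| + |4 * r * Q|) / D := by
        rw [le_div_iff₀ hD0]; linarith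
      linarith
    have hC1 : 1 ≤ C := by
      have : 0 ≤ (|4 * s * Q| + |4 * r * Q|) / D := by positivity
      linarith
    exact abs_le_of_sq_le_sq (by nlinarith) (by linarith)
  refine ⟨C, fun n => ⟨hb _ ?_, hb _ ?_⟩⟩
  · have e : (2 * r * y n - (t - p) * x n) ^ 2 + D * x n ^ 2 = -(4 * r * Q) := by
      rw [hD]; linear_combination (-4 * r) * inv n - 4 * x n ^ 2 * hd
    have := neg_le_abs (4 * r * Q); have := abs_nonneg (4 * s * Q)
    nlinarith [sq_nonneg (2 * r * y n - (t - p) * x n)]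
  · have e : (2 * s * x n + (t - p) * y n) ^ 2 + D * y n ^ 2 = (4 * s * Q) := by
      rw [hD]; linear_combination (4 * s) * inv n - 4 * y n ^ 2 * hd
    have := le_abs_self (4 * s * Q); have := abs_nonneg (4 * r * Q)
    nlinarith [sq_nonneg (2 * s * x n + (t - p) * y n)]

lemma cone {m1 m2 m3 m4 : ℝ} (hdet : m1 * m4 - m2 * m3 = 1) :
    ∃ (σ C : ℝ) (a b c d : ℕ → ℝ), σ ^ 2 = 1 ∧ 1 ≤ C ∧
      (∀ n, |a n| ≤ C ∧ |b n| ≤ C ∧ |c n| ≤ C ∧ |d n| ≤ C) ∧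
      (∀ n, a n * d n - b n * c n = 1) ∧
      ∀ n y z, σ * ((a n * y + b n * z) * (c n * y + d n * z)) ≤
        σ * ((a (n + 1) * (m1 * y + m2 * z) + b (n + 1) * (m3 * y + m4 * z)) *
          (c (n + 1) * (m1 * y + m2 * z) + d (n + 1) * (m3 * y + m4 * z))) := by
  rcases lt_or_ge ((m1 + m4) ^ 2) 4 with htr | htr
  · -- elliptic
    set S : ℕ → ℝ × ℝ → ℝ × ℝ := fun n =>
      (fun z : ℝ × ℝ => (m4 * z.1 - m3 * z.2, -m2 * z.1 + m1 * z.2))^[n] with hS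
    have hS1 : ∀ n z, (S (n + 1) z).1 = m4 * (S n z).1 + (-m3) * (S n z).2 := by
      intro n z; simp only [hS, Function.iterate_succ_apply']; ring
    have hS2 : ∀ n z, (S (n + 1) z).2 = (-m2) * (S n z).1 + m1 * (S n z).2 := by
      intro n z; simp only [hS, Function.iterate_succ_apply']
    have bd : ∀ z, ∃ C, ∀ n, |(S n z).1| ≤ C ∧ |(S n z).2| ≤ C := fun z =>
      ell_bdd (p := m4) (r := -m3) (s := -m2) (t := m1) (by linarith) (by rw [add_comm]; exact htr) _ _
        (fun n => hS1 n z) (fun n => hS2 n z)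
    obtain ⟨C1, h1⟩ := bd (1, 0)
    obtain ⟨C2, h2⟩ := bd (0, 1)
    refine ⟨1, max 1 (max C1 C2), fun n => (S n (1, 0)).1, fun n => (S n (1, 0)).2,
      fun n => (S n (0, 1)).1, fun n => (S n (0, 1)).2, by norm_num, le_max_left _ _, ?_, ?_, ?_⟩
    · intro n
      have e1 : C1 ≤ max 1 (max C1 C2) := (le_max_left _ _).trans (le_max_right _ _)
      have e2 : C2 ≤ max 1 (max C1 C2) := (le_max_right _ _).trans (le_max_right _ _)
      exact ⟨(h1 n).1.trans e1, (h1 n).2.trans e1, (h2 n).1.trans e2, (h2 n).2.trans e2⟩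
    · intro n
      induction n with
      | zero => simp [hS]
      | succ n ih =>
        beta_reduce
        rw [hS1, hS1, hS2, hS2]
        linear_combination hdet + (m1 * m4 - m2 * m3) * ih
    · intro n y z
      beta_reduce
      rw [hS1, hS1, hS2, hS2]
      set a := (S n (1, 0)).1; set b := (S n (1, 0)).2; set c := (S n (0, 1)).1; set d := (S n (0, 1)).2
      have e1 : (m4 * a + -m3 * b) * (m1 * y + m2 * z) + (-m2 * a + m1 * b) * (m3 * y + m4 * z)
          = a * y + b * z := by linear_combination (a * y + b * z) * hdet
      have e2 : (m4 * c + -m3 * d) * (m1 * y + m2 * z) + (-m2 * c + m1 * d) * (m3 * y + m4 * z)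
          = c * y + d * z := by linear_combination (c * y + d * z) * hdet
      rw [e1, e2]
  · -- real eigenvalue
    obtain ⟨μ, hμ⟩ : ∃ μ : ℝ, μ ^ 2 - (m1 + m4) * μ + 1 = 0 := by
      have := Real.sq_sqrt (by linarith : 0 ≤ (m1 + m4) ^ 2 - 4)
      exact ⟨(m1 + m4 + Real.sqrt ((m1 + m4) ^ 2 - 4)) / 2, by nlinarith⟩
    have hμ0 : μ ≠ 0 := by rintro rfl; norm_num at hμ
    obtain ⟨f1, f2, hf, g1, g2⟩ : ∃ f1 f2 : ℝ, 0 < f1 ^ 2 + f2 ^ 2 ∧ m1 * f1 + m2 * f2 = μ * f1 ∧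
        m3 * f1 + m4 * f2 = μ * f2 := by
      by_cases h : m2 = 0 ∧ μ - m1 = 0
      · by_cases h' : μ - m4 = 0 ∧ m3 = 0
        · refine ⟨1, 0, by norm_num, by linarith [h.2], by linarith [h'.2]⟩
        · refine ⟨μ - m4, m3, ?_, by linear_combination -hμ - hdet, by ring⟩
          by_contra hn
          exact h' ⟨by nlinarith [sq_nonneg (μ - m4), sq_nonneg m3], by nlinarith [sq_nonneg (μ - m4), sq_nonneg m3]⟩
      · refine ⟨m2, μ - m1, ?_, by ring, by linear_combination -hμ - hdet⟩
        by_contra hn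
        exact h ⟨by nlinarith [sq_nonneg (μ - m1), sq_nonneg m2], by nlinarith [sq_nonneg (μ - m1), sq_nonneg m2]⟩
    obtain ⟨e1, e2, he, k1, k2⟩ : ∃ e1 e2 : ℝ, e1 ^ 2 + e2 ^ 2 = 1 ∧ m1 * e1 + m2 * e2 = μ * e1 ∧
        m3 * e1 + m4 * e2 = μ * e2 := by
      set ℓ := Real.sqrt (f1 ^ 2 + f2 ^ 2) with hℓ
      have hℓ0 : 0 < ℓ := Real.sqrt_pos.2 hf
      have hℓ2 : ℓ ^ 2 = f1 ^ 2 + f2 ^ 2 := Real.sq_sqrt hf.le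
      refine ⟨f1 / ℓ, f2 / ℓ, ?_, ?_, ?_⟩
      · rw [div_pow, div_pow, ← add_div, hℓ2, div_self hf.ne']
      · field_simp; linarith
      · field_simp; linarith
    have eb1 : |e1| ≤ 1 := abs_le_of_sq_le_sq (by nlinarith [sq_nonneg e2]) (by norm_num)
    have eb2 : |e2| ≤ 1 := abs_le_of_sq_le_sq (by nlinarith [sq_nonneg e1]) (by norm_num)
    set b := e1 * (-m1 * e2 + m2 * e1) + e2 * (-m3 * e2 + m4 * e1) with hb
    obtain ⟨σ, hσ, hσb⟩ : ∃ σ : ℝ, σ ^ 2 = 1 ∧ 0 ≤ σ * (b / μ) := by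
      rcases le_total 0 (b / μ) with h | h
      · exact ⟨1, by norm_num, by linarith⟩
      · exact ⟨-1, by norm_num, by linarith⟩
    refine ⟨σ, 1, fun _ => e1, fun _ => e2, fun _ => -e2, fun _ => e1, hσ, le_rfl,
      fun n => ⟨eb1, eb2, by rwa [abs_neg], eb1⟩, fun n => by linarith, ?_⟩
    intro n y z
    beta_reduce
    set ζ1 := e1 * y + e2 * z with hζ1
    set ζ2 := -e2 * y + e1 * z with hζ2
    have hy : y = ζ1 * e1 - ζ2 * e2 := by rw [hζ1, hζ2]; linear_combination -y * he
    have hz : z = ζ1 * e2 + ζ2 * e1 := by rw [hζ1, hζ2]; linear_combination -z * he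
    have P1 : e1 * (m1 * y + m2 * z) + e2 * (m3 * y + m4 * z) = μ * ζ1 + b * ζ2 := by
      rw [hy, hz, hb]
      linear_combination (e1 * ζ1) * k1 + (e2 * ζ1) * k2 + μ * ζ1 * he
    have P2 : -e2 * (m1 * y + m2 * z) + e1 * (m3 * y + m4 * z) =
        (-e2 * (-m1 * e2 + m2 * e1) + e1 * (-m3 * e2 + m4 * e1)) * ζ2 := by
      rw [hy, hz]
      linear_combination (-e2 * ζ1) * k1 + (e1 * ζ1) * k2
    set d := -e2 * (-m1 * e2 + m2 * e1) + e1 * (-m3 * e2 + m4 * e1) with hd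
    have P3 : μ * d = 1 := by
      rw [hd]
      linear_combination -μ * (-e2 * (-m1 * e2 + m2 * e1) + e1 * (-m3 * e2 + m4 * e1)) * he - (-e2 * (-m1 * e2 + m2 * e1) + e1 * (-m3 * e2 + m4 * e1)) * (e1 * k1 + e2 * k2) + (e1 * (-m1 * e2 + m2 * e1) + e2 * (-m3 * e2 + m4 * e1)) * (-e2 * k1 + e1 * k2) + (e1 ^ 2 + e2 ^ 2) ^ 2 * hdet + (e1 ^ 2 + e2 ^ 2 + 1) * he
    rw [P1, P2]
    have hd' : d = 1 / μ := by field_simp; linarith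
    have : (μ * ζ1 + b * ζ2) * (d * ζ2) = ζ1 * ζ2 + b / μ * ζ2 ^ 2 := by
      rw [hd']; field_simp
    rw [this]
    have e : σ * (ζ1 * ζ2 + b / μ * ζ2 ^ 2) = σ * (ζ1 * ζ2) + σ * (b / μ) * ζ2 ^ 2 := by ring
    rw [e]
    linarith [mul_nonneg hσb (sq_nonneg ζ2)]


lemma gap_ptw {k C2 Cw T η f w φ z1 z2 U1 U2 F1 F2 σ : ℝ} (hT : 0 < T) (hη : 0 < η) (hη1 : η ≤ 1)
    (hk : 0 < k) (hC2 : 0 ≤ C2) (hCw : 0 ≤ Cw) (hσ : |σ| ≤ 1)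
    (hU1 : |U1| ≤ k) (hU2 : |U2| ≤ k) (hF1 : |F1| ≤ C2 * η) (hF2 : |F2| ≤ C2 * η)
    (hw : |w| ≤ Cw * η) (hφ : φ = U1 * z1 + U2 * z2)
    (hs : 16 * T * (C2 * Cw * k ^ 2) * η ≤ 1) :
    η / (4 * T * k ^ 2) * φ ^ 2 - 2 * T * ((1 + 2 * C2) * k) ^ 2 / η * f ^ 2 ≤
      (η / T) * (z1 ^ 2 + z2 ^ 2) + σ * f * (U2 * z2 - U1 * z1) +
        2 * (F1 * z1 * U2 - F2 * z2 * U1) * (f - w * φ) := by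
  set s := |z1| + |z2| with hsdef
  have hs0 : 0 ≤ s := by positivity
  have s2 : s ^ 2 ≤ 2 * (z1 ^ 2 + z2 ^ 2) := by
    rw [hsdef]; nlinarith [sq_nonneg (|z1| - |z2|), sq_abs z1, sq_abs z2]
  have b1 : |U1 * z1| ≤ k * |z1| := by rw [abs_mul]; gcongr
  have b2 : |U2 * z2| ≤ k * |z2| := by rw [abs_mul]; gcongr
  have bφ : |φ| ≤ k * s := by
    rw [hφ]; refine (abs_add_le _ _).trans ?_; rw [hsdef]; linarith
  have bm : |U2 * z2 - U1 * z1| ≤ k * s := by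
    refine (abs_sub _ _).trans ?_; rw [hsdef]; linarith
  have bF : |F1 * z1 * U2 - F2 * z2 * U1| ≤ C2 * η * k * s := by
    refine (abs_sub _ _).trans ?_
    have e1 : |F1 * z1 * U2| ≤ C2 * η * |z1| * k := by rw [abs_mul, abs_mul]; gcongr
    have e2 : |F2 * z2 * U1| ≤ C2 * η * |z2| * k := by rw [abs_mul, abs_mul]; gcongr
    rw [hsdef]; linarith
  have t1 : |σ * f * (U2 * z2 - U1 * z1)| ≤ 1 * |f| * (k * s) := by
    rw [abs_mul, abs_mul]; gcongr
  have t2 : |(F1 * z1 * U2 - F2 * z2 * U1) * f| ≤ C2 * k * s * |f| := by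
    rw [abs_mul]
    have : C2 * η * k * s ≤ C2 * k * s := by
      have : 0 ≤ C2 * k * s := by positivity
      nlinarith
    gcongr; linarith
  have t3 : |(F1 * z1 * U2 - F2 * z2 * U1) * (w * φ)| ≤ C2 * η * k * s * (Cw * η * (k * s)) := by
    rw [abs_mul, abs_mul w]; gcongr
  have t4 : C2 * η * k * s * (Cw * η * (k * s)) ≤ η / (16 * T) * s ^ 2 := by
    have : C2 * η * k * s * (Cw * η * (k * s)) = (16 * T * (C2 * Cw * k ^ 2) * η) * (η / (16 * T) * s ^ 2) := by
      field_simp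
    rw [this]
    have : 0 ≤ η / (16 * T) * s ^ 2 := by positivity
    nlinarith
  have t5 : (1 + 2 * C2) * k * s * |f| ≤ η / (8 * T) * s ^ 2 + 2 * T * ((1 + 2 * C2) * k) ^ 2 / η * f ^ 2 := by
    have e : η / (8 * T) * s ^ 2 + 2 * T * ((1 + 2 * C2) * k) ^ 2 / η * f ^ 2 - (1 + 2 * C2) * k * s * |f|
       = (8 * T / η) * (η / (8 * T) * s - (1 + 2 * C2) * k / 2 * |f|) ^ 2 := by
      rw [← sq_abs f]; field_simp; ring
    have : 0 ≤ (8 * T / η) * (η / (8 * T) * s - (1 + 2 * C2) * k / 2 * |f|) ^ 2 := by positivity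
    linarith
  have t6 : η / (4 * T * k ^ 2) * φ ^ 2 ≤ η / (4 * T) * s ^ 2 := by
    have : φ ^ 2 ≤ (k * s) ^ 2 := by rw [← sq_abs φ]; gcongr
    calc η / (4 * T * k ^ 2) * φ ^ 2 ≤ η / (4 * T * k ^ 2) * (k * s) ^ 2 := by gcongr
      _ = _ := by field_simp
  have t7 : η / (2 * T) * s ^ 2 ≤ (η / T) * (z1 ^ 2 + z2 ^ 2) := by
    calc η / (2 * T) * s ^ 2 ≤ η / (2 * T) * (2 * (z1 ^ 2 + z2 ^ 2)) := by gcongr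
      _ = _ := by field_simp
  have e4 : η / (4 * T) * s ^ 2 = 4 * (η / (16 * T) * s ^ 2) := by ring
  have e2 : η / (2 * T) * s ^ 2 = 8 * (η / (16 * T) * s ^ 2) := by ring
  have e8 : η / (8 * T) * s ^ 2 = 2 * (η / (16 * T) * s ^ 2) := by ring
  have r1 := (abs_le.1 t1).1
  have r2 := (abs_le.1 t2).1
  have r3 := (abs_le.1 t3).2
  have e : 2 * (F1 * z1 * U2 - F2 * z2 * U1) * (f - w * φ) = 2 * ((F1 * z1 * U2 - F2 * z2 * U1) * f) -
    2 * ((F1 * z1 * U2 - F2 * z2 * U1) * (w * φ)) := by ring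
  have e' : (1 + 2 * C2) * k * s * |f| = 1 * |f| * (k * s) + 2 * (C2 * k * s * |f|) := by ring
  rw [e]
  rw [e4] at t6
  rw [e2] at t7
  rw [e8, e'] at t5
  clear_value s
  generalize η / (16 * T) * s ^ 2 = X at *
  linarith only [r1, r2, r3, t4, t5, t6, t7]

lemma gap_block {q : ℝ → ℝ} {T : ℝ} (hT : 0 < T) (hq : Continuous q) {u v u' v' : ℝ → ℝ}
    (h : Fund q T u v u' v')
    {K C Cw η σ a b c d : ℝ} (hK : 0 < K) (hKu : ∀ t ∈ Icc 0 T, |u t| ≤ K) (hKv : ∀ t ∈ Icc 0 T, |v t| ≤ K)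
    (hC : 0 < C) (ha : |a| ≤ C) (hb : |b| ≤ C) (hc : |c| ≤ C) (hd : |d| ≤ C) (hdet : a * d - b * c = 1)
    (hσ : σ ^ 2 = 1) (hη : 0 < η) (hη1 : η ≤ 1) (hCw : 0 ≤ Cw)
    (hs : 16 * T * ((1 + T * Cw * (2 * C * K) ^ 2) * Cw * (2 * C * K) ^ 2) * η ≤ 1)
    {w : ℝ → ℝ} (kw : Continuous w) (hw : ∀ t ∈ Icc 0 T, |w t| ≤ Cw * η)
    (w1 : (∫ t in (0:ℝ)..T, w t * u t ^ 2) = σ * η * (a ^ 2 - c ^ 2))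
    (w2 : (∫ t in (0:ℝ)..T, w t * (u t * v t)) = σ * η * (a * b - c * d))
    (w3 : (∫ t in (0:ℝ)..T, w t * v t ^ 2) = σ * η * (b ^ 2 - d ^ 2))
    {φ φ' φ'' : ℝ → ℝ} (d1 : ∀ t, HasDerivAt φ (φ' t) t) (d2 : ∀ t, HasDerivAt φ' (φ'' t) t)
    (kφ'' : Continuous φ'') :
    σ * ((a * φ 0 + b * φ' 0) * (c * φ 0 + d * φ' 0)) +
      η / (4 * T * (2 * C * K) ^ 2) * (∫ t in (0:ℝ)..T, φ t ^ 2) -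
      2 * T * ((1 + 2 * (1 + T * Cw * (2 * C * K) ^ 2)) * (2 * C * K)) ^ 2 / η *
        (∫ t in (0:ℝ)..T, (-φ'' t + (q t + w t) * φ t) ^ 2) ≤
    σ * ((a * (v' T * φ T - v T * φ' T) + b * (-u' T * φ T + u T * φ' T)) *
      (c * (v' T * φ T - v T * φ' T) + d * (-u' T * φ T + u T * φ' T))) := by
  have ku := h.cu
  have kv := h.cv
  have ku' := h.cu'
  have kv' := h.cv'
  have kφ : Continuous φ := continuous_iff_continuousAt.2 fun t => (d1 t).continuousAt
  have kφ' : Continuous φ' := continuous_iff_continuousAt.2 fun t => (d2 t).continuousAt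
  set k := 2 * C * K with hk
  have hk0 : 0 < k := by positivity
  set C2 := 1 + T * Cw * k ^ 2 with hC2
  set U1 : ℝ → ℝ := fun t => d * u t - c * v t with hU1
  set U2 : ℝ → ℝ := fun t => -b * u t + a * v t with hU2
  have kU1 : Continuous U1 := by fun_prop
  have kU2 : Continuous U2 := by fun_prop
  have bU1 : ∀ t ∈ Icc 0 T, |U1 t| ≤ k := fun t ht => by
    refine (abs_sub _ _).trans ?_
    rw [abs_mul, abs_mul, hk]
    have := mul_le_mul hd (hKu t ht) (abs_nonneg _) hC.le
    have := mul_le_mul hc (hKv t ht) (abs_nonneg _) hC.le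
    linarith
  have bU2 : ∀ t ∈ Icc 0 T, |U2 t| ≤ k := fun t ht => by
    refine (abs_add_le _ _).trans ?_
    rw [abs_mul, abs_mul, hk, abs_neg]
    have := mul_le_mul hb (hKu t ht) (abs_nonneg _) hC.le
    have := mul_le_mul ha (hKv t ht) (abs_nonneg _) hC.le
    linarith
  have ii : ∀ f : ℝ → ℝ, Continuous f → IntervalIntegrable f volume 0 T :=
    fun f hf => hf.intervalIntegrable _ _
  have lin : ∀ x y : ℝ, (∫ t in (0:ℝ)..T, w t * (x * u t + y * v t) ^ 2) =
      σ * η * (x ^ 2 * (a ^ 2 - c ^ 2) + 2 * x * y * (a * b - c * d) + y ^ 2 * (b ^ 2 - d ^ 2)) := by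
    intro x y
    have e : ∀ t, w t * (x * u t + y * v t) ^ 2 =
      (x ^ 2 * (w t * u t ^ 2) + 2 * x * y * (w t * (u t * v t))) + y ^ 2 * (w t * v t ^ 2) := fun t => by ring
    simp only [e]
    rw [intervalIntegral.integral_add (ii _ (by fun_prop)) (ii _ (by fun_prop)),
      intervalIntegral.integral_add (ii _ (by fun_prop)) (ii _ (by fun_prop)),
      intervalIntegral.integral_const_mul, intervalIntegral.integral_const_mul,
      intervalIntegral.integral_const_mul, w1, w2, w3]
    ring
  have I1 : ∫ t in (0:ℝ)..T, w t * U1 t ^ 2 = σ * η := by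
    have e : ∀ t, U1 t = d * u t + (-c) * v t := fun t => by simp only [hU1]; ring
    simp only [e]
    rw [lin]; linear_combination (σ * η * (a * d - b * c + 1)) * hdet
  have I2 : ∫ t in (0:ℝ)..T, w t * U2 t ^ 2 = -(σ * η) := by
    rw [lin]; linear_combination (-σ * η * (a * d - b * c + 1)) * hdet
  have hσ1 : |σ| ≤ 1 := abs_le_of_sq_le_sq (by linarith) (by norm_num)
  have bF : ∀ U : ℝ → ℝ, Continuous U → (∀ t ∈ Icc 0 T, |U t| ≤ k) → ∀ ρ : ℝ, |ρ| ≤ 1 → ∀ t ∈ Icc 0 T,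
      |η / T * t - ρ * ∫ s in (0:ℝ)..t, w s * U s ^ 2| ≤ C2 * η := by
    intro U kU bU ρ hρ t ht
    have e1 : |η / T * t| ≤ η := by
      rw [abs_of_nonneg (mul_nonneg (by positivity) ht.1), div_mul_eq_mul_div, div_le_iff₀ hT]
      exact mul_le_mul_of_nonneg_left ht.2 hη.le
    have e2 : |∫ s in (0:ℝ)..t, w s * U s ^ 2| ≤ Cw * η * k ^ 2 * T := by
      have := intervalIntegral.norm_integral_le_of_norm_le_const (f := fun s => w s * U s ^ 2)
        (a := 0) (b := t) (C := Cw * η * k ^ 2) (by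
          intro s hs
          rw [uIoc_of_le ht.1] at hs
          have hs' : s ∈ Icc 0 T := ⟨hs.1.le, hs.2.trans ht.2⟩
          rw [Real.norm_eq_abs, abs_mul, abs_pow]
          have := hw s hs'
          have := bU s hs'
          gcongr)
      rw [Real.norm_eq_abs, sub_zero, abs_of_nonneg ht.1] at this
      refine this.trans ?_
      have := ht.2
      gcongr
    refine (abs_sub _ _).trans ?_
    rw [abs_mul ρ]
    have : |ρ| * |∫ s in (0:ℝ)..t, w s * U s ^ 2| ≤ 1 * (Cw * η * k ^ 2 * T) := by gcongr
    rw [hC2]; linarith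
  set F1 : ℝ → ℝ := fun t => η / T * t - σ * ∫ s in (0:ℝ)..t, w s * U1 s ^ 2 with hF1
  set F2 : ℝ → ℝ := fun t => η / T * t - (-σ) * ∫ s in (0:ℝ)..t, w s * U2 s ^ 2 with hF2
  have dF1 : ∀ t, HasDerivAt F1 (η / T - σ * (w t * U1 t ^ 2)) t := fun t => by
    have := ((hasDerivAt_id t).const_mul (η / T)).sub
      ((((kw.mul (kU1.pow 2)).integral_hasStrictDerivAt 0 t).hasDerivAt).const_mul σ)
    refine this.congr_deriv ?_
    simp
  have dF2 : ∀ t, HasDerivAt F2 (η / T + σ * (w t * U2 t ^ 2)) t := fun t => by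
    have := ((hasDerivAt_id t).const_mul (η / T)).sub
      ((((kw.mul (kU2.pow 2)).integral_hasStrictDerivAt 0 t).hasDerivAt).const_mul (-σ))
    refine this.congr_deriv ?_
    simp
  have kF1 : Continuous F1 := continuous_iff_continuousAt.2 fun t => (dF1 t).continuousAt
  have kF2 : Continuous F2 := continuous_iff_continuousAt.2 fun t => (dF2 t).continuousAt
  set z1 : ℝ → ℝ := fun t => a * (v' t * φ t - v t * φ' t) + b * (-u' t * φ t + u t * φ' t) with hz1
  set z2 : ℝ → ℝ := fun t => c * (v' t * φ t - v t * φ' t) + d * (-u' t * φ t + u t * φ' t) with hz2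
  have kz1 : Continuous z1 := by fun_prop
  have kz2 : Continuous z2 := by fun_prop
  set f : ℝ → ℝ := fun t => -φ'' t + (q t + w t) * φ t with hf
  have kf : Continuous f := by fun_prop
  have dy1 : ∀ t ∈ Ioo 0 T, HasDerivAt (fun t => v' t * φ t - v t * φ' t) (v t * (f t - w t * φ t)) t := by
    intro t ht
    refine (((h.dv' t ht).mul (d1 t)).sub ((h.dv t ht).mul (d2 t))).congr_deriv ?_
    simp only [hf]; ring
  have dy2 : ∀ t ∈ Ioo 0 T, HasDerivAt (fun t => -u' t * φ t + u t * φ' t) (-u t * (f t - w t * φ t)) t := by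
    intro t ht
    refine (((h.du' t ht).neg.mul (d1 t)).add ((h.du t ht).mul (d2 t))).congr_deriv ?_
    simp only [hf, Pi.neg_apply]; ring
  have dz1 : ∀ t ∈ Ioo 0 T, HasDerivAt z1 (U2 t * (f t - w t * φ t)) t := by
    intro t ht
    refine (((dy1 t ht).const_mul a).add ((dy2 t ht).const_mul b)).congr_deriv ?_
    simp only [hU2]; ring
  have dz2 : ∀ t ∈ Ioo 0 T, HasDerivAt z2 (-U1 t * (f t - w t * φ t)) t := by
    intro t ht
    refine (((dy1 t ht).const_mul c).add ((dy2 t ht).const_mul d)).congr_deriv ?_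
    simp only [hU1]; ring
  have hφ : ∀ t ∈ Icc 0 T, φ t = U1 t * z1 t + U2 t * z2 t := by
    intro t ht
    have := h.wr t ht
    simp only [hU1, hU2, hz1, hz2]
    linear_combination (-φ t) * this - φ t * (u t * v' t - u' t * v t) * hdet
  set L : ℝ → ℝ := fun t => σ * (z1 t * z2 t) + F1 t * z1 t ^ 2 + F2 t * z2 t ^ 2 with hL
  set L' : ℝ → ℝ := fun t => (η / T) * (z1 t ^ 2 + z2 t ^ 2) + σ * f t * (U2 t * z2 t - U1 t * z1 t) +
        2 * (F1 t * z1 t * U2 t - F2 t * z2 t * U1 t) * (f t - w t * φ t) with hL'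
  have kL : Continuous L := by fun_prop
  have kL' : Continuous L' := by fun_prop
  have dL : ∀ t ∈ Ioo 0 T, HasDerivAt L (L' t) t := by
    intro t ht
    have := ((((dz1 t ht).mul (dz2 t ht)).const_mul σ).add ((dF1 t).mul ((dz1 t ht).pow 2))).add
      ((dF2 t).mul ((dz2 t ht).pow 2))
    refine this.congr_deriv ?_
    have e := hφ t ⟨ht.1.le, ht.2.le⟩
    simp only [hL', Pi.pow_apply]
    norm_num
    linear_combination (-σ * w t * (U2 t * z2 t - U1 t * z1 t)) * e
  have FTC := intervalIntegral.integral_eq_sub_of_hasDerivAt_of_le hT.le kL.continuousOn dL (ii _ kL')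
  have mono : ∫ t in (0:ℝ)..T, (η / (4 * T * k ^ 2) * φ t ^ 2 -
      2 * T * ((1 + 2 * C2) * k) ^ 2 / η * f t ^ 2) ≤ ∫ t in (0:ℝ)..T, L' t := by
    refine intervalIntegral.integral_mono_on hT.le (ii _ (by fun_prop)) (ii _ kL') ?_
    intro t ht
    exact gap_ptw hT hη hη1 hk0 (by positivity) hCw hσ1 (bU1 t ht) (bU2 t ht)
      (bF U1 kU1 bU1 σ hσ1 t ht) (bF U2 kU2 bU2 (-σ) (by rwa [abs_neg]) t ht) (hw t ht) (hφ t ht) hs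
  rw [intervalIntegral.integral_sub (ii _ (by fun_prop)) (ii _ (by fun_prop)),
    intervalIntegral.integral_const_mul, intervalIntegral.integral_const_mul, FTC] at mono
  have LT : L T = σ * (z1 T * z2 T) := by
    have e1 : F1 T = 0 := by
      simp only [hF1]; rw [I1, div_mul_cancel₀ _ hT.ne']; linear_combination (-η) * hσ
    have e2 : F2 T = 0 := by
      simp only [hF2]; rw [I2, div_mul_cancel₀ _ hT.ne']; linear_combination (-η) * hσ
    simp only [hL]; rw [e1, e2]; ring
  have L0 : L 0 = σ * ((a * φ 0 + b * φ' 0) * (c * φ 0 + d * φ' 0)) := by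
    simp only [hL, hF1, hF2, hz1, hz2]
    rw [h.u0, h.v0, h.u'0, h.v'0]; simp
  rw [LT, L0] at mono
  linarith


lemma gap_lemma {q : ℝ → ℝ} {T : ℝ} (hT : 0 < T) (hq : Continuous q) (hper : Function.Periodic q T)
    {B : ℝ} (hB1 : 1 ≤ B) (hB : ∀ x, |q x| ≤ B) {ε : ℝ} (hε : 0 < ε) :
    ∃ w : ℝ → ℝ, Continuous w ∧ (∀ x, |w x| ≤ ε) ∧ ∃ c, 0 < c ∧ Res (Ioi 0) (fun x => q x + w x) c := by
  obtain ⟨u, v, u', v', h⟩ := exists_fund hq hB1 hB hT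
  have hMdet : u T * v' T - v T * u' T = 1 := by
    have := h.wr T ⟨hT.le, le_rfl⟩; linarith
  obtain ⟨σ, C, a, b, c, d, hσ, hC1, hbd, hdet, hmono⟩ := cone hMdet
  obtain ⟨Cg, hCg, hgram⟩ := gram hT h
  have bd : ∀ f : ℝ → ℝ, Continuous f → ∃ C, 0 ≤ C ∧ ∀ t ∈ Icc 0 T, |f t| ≤ C := by
    intro f hf
    obtain ⟨C, hC⟩ := isCompact_Icc.exists_bound_of_continuousOn (hf.continuousOn (s := Icc 0 T))
    exact ⟨C, (norm_nonneg _).trans (hC 0 ⟨le_rfl, hT.le⟩), hC⟩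
  obtain ⟨Ku, hKu0, hKu⟩ := bd u h.cu
  obtain ⟨Kv, hKv0, hKv⟩ := bd v h.cv
  set K := Ku + Kv + 1 with hK
  have hK0 : 0 < K := by positivity
  have hC0 : 0 < C := by linarith
  set Cw := Cg * (2 * C ^ 2) with hCw
  have hCw0 : 0 ≤ Cw := by positivity
  set X := 16 * T * ((1 + T * Cw * (2 * C * K) ^ 2) * Cw * (2 * C * K) ^ 2) with hX
  have hX0 : 0 ≤ X := by positivity
  obtain ⟨η, hη, hη1, hηε, hηX⟩ : ∃ η : ℝ, 0 < η ∧ η ≤ 1 ∧ Cw * η ≤ ε ∧ X * η ≤ 1 := by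
    refine ⟨min 1 (min (ε / (Cw + 1)) (1 / (X + 1))), ?_, min_le_left _ _, ?_, ?_⟩
    · refine lt_min one_pos (lt_min (by positivity) (by positivity))
    · calc Cw * _ ≤ (Cw + 1) * (ε / (Cw + 1)) := by
            refine mul_le_mul (by linarith) ((min_le_right _ _).trans (min_le_left _ _)) ?_ (by linarith)
            exact (lt_min one_pos (lt_min (by positivity) (by positivity))).le
        _ = ε := by field_simp
    · calc X * _ ≤ (X + 1) * (1 / (X + 1)) := by
            refine mul_le_mul (by linarith) ((min_le_right _ _).trans (min_le_right _ _)) ?_ (by linarith)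
            exact (lt_min one_pos (lt_min (by positivity) (by positivity))).le
        _ = 1 := by field_simp
  have hσ1 : |σ| ≤ 1 := abs_le_of_sq_le_sq (by linarith) (by norm_num)
  have sb : ∀ x y z w : ℝ, |x| ≤ C → |y| ≤ C → |z| ≤ C → |w| ≤ C → |σ * η * (x * y - z * w)| ≤ 2 * C ^ 2 * η := by
    intro x y z w hx hy hz hw
    have e : |x * y - z * w| ≤ 2 * C ^ 2 := by
      refine (abs_sub _ _).trans ?_
      rw [abs_mul, abs_mul]
      have := mul_le_mul hx hy (abs_nonneg _) hC0.le
      have := mul_le_mul hz hw (abs_nonneg _) hC0.le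
      linarith
    rw [abs_mul, abs_mul, abs_of_pos hη]
    calc |σ| * η * |x * y - z * w| ≤ 1 * η * (2 * C ^ 2) := by gcongr
      _ = _ := by ring
  have hw : ∀ n : ℕ, ∃ w : ℝ → ℝ, Continuous w ∧
      w 0 = 0 ∧ w T = 0 ∧ (∀ t ∈ Icc 0 T, |w t| ≤ Cw * η) ∧
      (∫ t in (0:ℝ)..T, w t * u t ^ 2) = σ * η * (a n ^ 2 - c n ^ 2) ∧
      (∫ t in (0:ℝ)..T, w t * (u t * v t)) = σ * η * (a n * b n - c n * d n) ∧
      (∫ t in (0:ℝ)..T, w t * v t ^ 2) = σ * η * (b n ^ 2 - d n ^ 2) := by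
    intro n
    obtain ⟨ha, hb, hc, hd⟩ := hbd n
    obtain ⟨w, k, w0, wT, wb, i1, i2, i3⟩ := hgram (σ * η * (a n ^ 2 - c n ^ 2)) (σ * η * (a n * b n - c n * d n))
      (σ * η * (b n ^ 2 - d n ^ 2)) (2 * C ^ 2 * η)
      (by rw [sq, sq]; exact sb _ _ _ _ ha ha hc hc) (sb _ _ _ _ ha hb hc hd)
      (by rw [sq, sq]; exact sb _ _ _ _ hb hb hd hd)
    exact ⟨w, k, w0, wT, fun t ht => (wb t ht).trans (by rw [hCw]; apply le_of_eq; ring), i1, i2, i3⟩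
  choose w kw w0 wT wb wi1 wi2 wi3 using hw
  obtain ⟨G, kG, hG, hGb⟩ := concat_fun (ε := ε) hT (fun n : ℤ => w n.toNat)
    (fun n => (kw _).continuousOn) (fun n => w0 _) (fun n => wT _)
    (fun n t ht => (wb _ t ht).trans hηε)
  refine ⟨G, kG, hGb, ?_⟩
  set κ := η / (4 * T * (2 * C * K) ^ 2) with hκ
  set D := 2 * T * ((1 + 2 * (1 + T * Cw * (2 * C * K) ^ 2)) * (2 * C * K)) ^ 2 / η with hD
  have hκ0 : 0 < κ := by positivity
  have hD0 : 0 < D := by positivity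
  refine ⟨κ / D, by positivity, ?_⟩
  intro φ hφ hcs hsupp
  have kφ : Continuous φ := hφ.continuous
  have kφ'' : Continuous (deriv (deriv φ)) := c2_cont'' hφ
  have d1 : ∀ t, HasDerivAt φ (deriv φ t) t := fun t => (c2_diff hφ t).hasDerivAt
  have d2 : ∀ t, HasDerivAt (deriv φ) (deriv (deriv φ) t) t := fun t => (c2_diff' hφ t).hasDerivAt
  set f : ℝ → ℝ := fun x => -deriv (deriv φ) x + (q x + G x) * φ x with hf
  have kf : Continuous f := by fun_prop
  set Q : ℕ → ℝ := fun n => σ * ((a n * φ (n * T) + b n * deriv φ (n * T)) *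
    (c n * φ (n * T) + d n * deriv φ (n * T))) with hQ
  have step : ∀ n : ℕ, Q n + κ * (∫ t in (n * T : ℝ)..(n * T + T), φ t ^ 2) -
      D * (∫ t in (n * T : ℝ)..(n * T + T), f t ^ 2) ≤ Q (n + 1) := by
    intro n
    obtain ⟨ha, hb, hc, hd⟩ := hbd n
    have B1 := gap_block hT hq h hK0 (fun t ht => (hKu t ht).trans (by rw [hK]; linarith))
      (fun t ht => (hKv t ht).trans (by rw [hK]; linarith)) hC0 ha hb hc hd (hdet n) hσ hη hη1 hCw0 hηX
      (kw n) (wb n) (wi1 n) (wi2 n) (wi3 n)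
      (φ := fun t => φ (n * T + t)) (φ' := fun t => deriv φ (n * T + t))
      (φ'' := fun t => deriv (deriv φ) (n * T + t))
      (fun t => (d1 _).comp_const_add _ _) (fun t => (d2 _).comp_const_add _ _)
      (kφ''.comp (continuous_const.add continuous_id))
    beta_reduce at B1
    have i1 : ∫ t in (0:ℝ)..T, φ (n * T + t) ^ 2 = ∫ t in (n * T : ℝ)..(n * T + T), φ t ^ 2 := by
      rw [intervalIntegral.integral_comp_add_left (fun t => φ t ^ 2), add_zero]
    have i2 : ∫ t in (0:ℝ)..T, (-deriv (deriv φ) (n * T + t) + (q t + w n t) * φ (n * T + t)) ^ 2 =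
        ∫ t in (n * T : ℝ)..(n * T + T), f t ^ 2 := by
      have : ∫ t in (0:ℝ)..T, (-deriv (deriv φ) (n * T + t) + (q t + w n t) * φ (n * T + t)) ^ 2 =
          ∫ t in (0:ℝ)..T, f (n * T + t) ^ 2 := by
        refine intervalIntegral.integral_congr fun t ht => ?_
        rw [uIcc_of_le hT.le] at ht
        have e1 : G (n * T + t) = w n t := by
          have := hG n t ht
          simpa using this
        have e2 : q (n * T + t) = q t := by
          rw [add_comm]; exact hper.nat_mul n t
        simp only [hf, e1, e2]
      rw [this, intervalIntegral.integral_comp_add_left (fun t => f t ^ 2), add_zero]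
    rw [i1, i2, add_zero] at B1
    refine B1.trans ?_
    refine (hmono n _ _).trans (le_of_eq ?_)
    have eT : ((n + 1 : ℕ) : ℝ) * T = n * T + T := by push_cast; ring
    simp only [hQ]
    rw [eT]
    have y1 : u T * (v' T * φ (n * T + T) - v T * deriv φ (n * T + T)) +
      v T * (-u' T * φ (n * T + T) + u T * deriv φ (n * T + T)) = φ (n * T + T) := by
      linear_combination φ (n * T + T) * hMdet
    have y2 : u' T * (v' T * φ (n * T + T) - v T * deriv φ (n * T + T)) +
      v' T * (-u' T * φ (n * T + T) + u T * deriv φ (n * T + T)) = deriv φ (n * T + T) := by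
      linear_combination deriv φ (n * T + T) * hMdet
    rw [y1, y2]
  have φ0 : φ 0 = 0 := hsupp 0 (by simp)
  have φ0' : deriv φ 0 = 0 := by
    have h1 : HasDerivWithinAt φ (deriv φ 0) (Iic 0) 0 := (d1 0).hasDerivWithinAt
    have h2 : HasDerivWithinAt φ 0 (Iic 0) 0 :=
      (hasDerivWithinAt_const (0:ℝ) (Iic 0) (0:ℝ)).congr (fun x hx => hsupp x (by simpa using hx)) φ0
    exact (uniqueDiffOn_Iic (0:ℝ) 0 (by simp)).eq_deriv _ h1 h2
  have tele : ∀ n : ℕ, κ * (∫ t in (0:ℝ)..(n * T), φ t ^ 2) - D * (∫ t in (0:ℝ)..(n * T), f t ^ 2) ≤ Q n := by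
    intro n
    induction n with
    | zero => simp [hQ, φ0, φ0']
    | succ n ih =>
      have eT : ((n + 1 : ℕ) : ℝ) * T = n * T + T := by push_cast; ring
      have := step n
      rw [eT]
      have i1 := intervalIntegral.integral_add_adjacent_intervals (μ := volume)
        ((kφ.pow 2).intervalIntegrable 0 (n * T)) ((kφ.pow 2).intervalIntegrable (n * T) (n * T + T))
      have i2 := intervalIntegral.integral_add_adjacent_intervals (μ := volume)
        ((kf.pow 2).intervalIntegrable 0 (n * T)) ((kf.pow 2).intervalIntegrable (n * T) (n * T + T))
      simp only [Pi.pow_apply] at i1 i2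
      rw [← i1, ← i2]
      linarith
  obtain ⟨R, hR⟩ := hcs.isCompact.isBounded.subset_closedBall 0
  obtain ⟨N, hN⟩ := exists_nat_gt (R / T)
  rw [div_lt_iff₀ hT] at hN
  have hNT : ∀ x, N * T ≤ x → x ∉ tsupport φ := by
    intro x hx hx'
    have := hR hx'
    rw [mem_closedBall_zero_iff, Real.norm_eq_abs] at this
    have := le_abs_self x
    linarith
  have z1 : φ (N * T) = 0 := image_eq_zero_of_notMem_tsupport (hNT _ le_rfl)
  have z2 : deriv φ (N * T) = 0 := by
    by_contra hne
    exact hNT _ le_rfl (support_deriv_subset hne)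
  have := tele N
  simp only [hQ, z1, z2] at this
  have i1 : ∫ t in (0:ℝ)..(N * T), φ t ^ 2 = ∫ t, φ t ^ 2 := by
    apply intervalIntegral.integral_eq_integral_of_support_subset
    intro x hx
    have hx' : φ x ≠ 0 := by
      intro h0; apply hx; simp [h0]
    refine ⟨?_, ?_⟩
    · by_contra hn; exact hx' (hsupp x hn)
    · by_contra hn
      push Not at hn
      exact hNT x hn.le (subset_tsupport _ hx')
  have i2 : ∫ t in (0:ℝ)..(N * T), f t ^ 2 ≤ ∫ t, f t ^ 2 := by
    rw [intervalIntegral.integral_of_le (by positivity)]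
    exact setIntegral_le_integral (int_op (hq.add kG) hφ hcs) (ae_of_all _ fun x => sq_nonneg _)
  rw [i1] at this
  have i3 := mul_le_mul_of_nonneg_left i2 hD0.le
  rw [div_mul_eq_mul_div, div_le_iff₀ hD0]
  simp only [mul_zero, add_zero] at this
  show κ * (∫ t, φ t ^ 2) ≤ (∫ t, f t ^ 2) * D
  linarith


lemma finite_cover {V : ℝ → ℝ} {T : ℝ} (hT : 0 < T) (hV : Continuous V) (hper : Function.Periodic V T)
    {B : ℝ} (hB : ∀ x, |V x| ≤ B) {ε : ℝ} (hε : 0 < ε) (R Λ : ℝ) (hΛ : 0 < Λ) :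
    ∃ (l : List (ℝ → ℝ)) (c : ℝ), 0 < c ∧ (∀ W ∈ l, Continuous W ∧ ∀ x, |W x - V x| ≤ ε) ∧
      ∀ p ∈ Icc Λ⁻¹ Λ ×ˢ Icc (-R) R, ∃ W ∈ l, Res (Ioi 0) (fun x => p.1 * W x - p.2) c := by
  have hcomp : IsCompact (Icc Λ⁻¹ Λ ×ˢ Icc (-R) R) := isCompact_Icc.prod isCompact_Icc
  refine hcomp.induction_on (p := fun s : Set (ℝ × ℝ) => ∃ (l : List (ℝ → ℝ)) (c : ℝ), 0 < c ∧
    (∀ W ∈ l, Continuous W ∧ ∀ x, |W x - V x| ≤ ε) ∧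
      ∀ p ∈ s, ∃ W ∈ l, Res (Ioi 0) (fun x => p.1 * W x - p.2) c) ?_ ?_ ?_ ?_
  · exact ⟨[], 1, one_pos, by simp, by simp⟩
  · rintro s t hst ⟨l, c, hc, h1, h2⟩
    exact ⟨l, c, hc, h1, fun p hp => h2 p (hst hp)⟩
  · rintro s t ⟨l, c, hc, h1, h2⟩ ⟨l', c', hc', h1', h2'⟩
    refine ⟨l ++ l', min c c', lt_min hc hc', ?_, ?_⟩
    · intro W hW
      rcases List.mem_append.1 hW with h | h
      · exact h1 W h
      · exact h1' W h
    · rintro p (hp | hp)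
      · obtain ⟨W, hW, hr⟩ := h2 p hp
        exact ⟨W, List.mem_append.2 (Or.inl hW), hr.mono_c (min_le_left _ _)⟩
      · obtain ⟨W, hW, hr⟩ := h2' p hp
        exact ⟨W, List.mem_append.2 (Or.inr hW), hr.mono_c (min_le_right _ _)⟩
  · rintro ⟨lam, E⟩ ⟨hlam, hE⟩
    have hl0 : 0 < lam := lt_of_lt_of_le (inv_pos.2 hΛ) hlam.1
    have hB0 : 0 ≤ B := (abs_nonneg _).trans (hB 0)
    obtain ⟨w, kw, hw, c, hc, hres⟩ := gap_lemma (q := fun x => lam * V x - E) (B := lam * B + |E| + 1) hT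
      (by fun_prop) (fun x => by simp only [hper x]) (by
        have : 0 ≤ lam * B := by positivity
        have := abs_nonneg E
        linarith) (fun x => by
        refine (abs_sub _ _).trans ?_
        rw [abs_mul, abs_of_pos hl0]
        have := mul_le_mul_of_nonneg_left (hB x) hl0.le
        linarith) (mul_pos hε hl0)
    set W : ℝ → ℝ := fun x => V x + w x / lam with hW
    have kW : Continuous W := by fun_prop
    have hWV : ∀ x, |W x - V x| ≤ ε := by
      intro x
      simp only [hW, add_sub_cancel_left, abs_div, abs_of_pos hl0]
      rw [div_le_iff₀ hl0]; exact hw x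
    have hWB : ∀ x, |W x| ≤ B + ε := by
      intro x
      have := hWV x
      have := hB x
      have e : W x = V x + (W x - V x) := by ring
      rw [e]; exact (abs_add_le _ _).trans (by linarith)
    have hres' : Res (Ioi 0) (fun x => lam * W x - E) c := by
      have : (fun x => lam * W x - E) = fun x => (lam * V x - E) + w x := by
        funext x; simp only [hW]; field_simp; ring
      rw [this]; exact hres
    set r := Real.sqrt c / 2 / (B + ε + 1) with hr
    have hsc : 0 < Real.sqrt c := Real.sqrt_pos.2 hc
    have hr0 : 0 < r := by positivity
    refine ⟨Metric.ball (lam, E) r, mem_nhdsWithin_of_mem_nhds (Metric.ball_mem_nhds _ hr0),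
      [W], c / 4, by positivity, ?_, ?_⟩
    · intro W' hW'
      rw [List.mem_singleton.1 hW']
      exact ⟨kW, hWV⟩
    · rintro ⟨lam', E'⟩ hp
      rw [Metric.mem_ball, Prod.dist_eq, max_lt_iff, Real.dist_eq, Real.dist_eq] at hp
      obtain ⟨p1, p2⟩ := hp
      refine ⟨W, by simp, hres'.perturb (a := Real.sqrt c / 2) (by fun_prop) (by fun_prop) ?_ ?_⟩
      · intro x
        have e : lam * W x - E - (lam' * W x - E') = -((lam' - lam) * W x) + (E' - E) := by ring
        beta_reduce
        rw [e]
        refine (abs_add_le _ _).trans ?_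
        rw [abs_neg, abs_mul]
        have h1 : |lam' - lam| * |W x| ≤ r * (B + ε) :=
          mul_le_mul p1.le (hWB x) (abs_nonneg _) hr0.le
        have h2 : r * (B + ε + 1) = Real.sqrt c / 2 := by rw [hr]; field_simp
        simp only at p2
        linarith
      · rw [div_pow, Real.sq_sqrt hc.le]; norm_num

lemma consts {T K c D δ : ℝ} (hT : 0 < T) (hK : 1 ≤ K) (hc : 0 < c) (hD : 0 ≤ D) (hδ : 0 < δ) (m : ℕ) :
    ∃ (n N p : ℕ) (η : ℝ), 0 < η ∧ η ≤ 1 ∧ 1 ≤ p ∧ D * (m * (N * T)) ^ 2 < p ∧ 2 * n + 6 ≤ N * T ∧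
      16 * K * (K / (K + c)) ^ n ≤ η ^ 2 ∧ (K / (K + c)) ^ n ≤ 1 / 16 ∧ m * (8 * (p + 1) ^ 2 * η) < δ := by
  set ρ := K / (K + c) with hρ
  have hK0 : 0 < K := by linarith
  have hρ0 : 0 < ρ := by positivity
  have hρ1 : ρ < 1 := by rw [hρ, div_lt_one (by positivity)]; linarith
  set r := Real.sqrt ρ with hr
  have hr0 : 0 < r := Real.sqrt_pos.2 hρ0
  have hr1 : r < 1 := by rw [hr, Real.sqrt_lt' one_pos]; linarith
  set k := 4 * Real.sqrt K with hk
  have hk0 : 0 < k := by have := Real.sqrt_pos.2 hK0; positivity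
  set A := m * (6 + T) with hA
  have hA0 : 0 ≤ A := by positivity
  set P := D * A ^ 2 + 3 with hP
  have t1 : Tendsto (fun n : ℕ => k * r ^ n) atTop (𝓝 (k * 0)) :=
    (tendsto_pow_atTop_nhds_zero_of_lt_one hr0.le hr1).const_mul _
  have t2 : Tendsto (fun n : ℕ => ρ ^ n) atTop (𝓝 0) := tendsto_pow_atTop_nhds_zero_of_lt_one hρ0.le hρ1
  have t3 : Tendsto (fun n : ℕ => (m * 8 * P ^ 2 * k / r) * (((n + 1 : ℕ) : ℝ) ^ 4 * r ^ (n + 1))) atTop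
      (𝓝 ((m * 8 * P ^ 2 * k / r) * 0)) := by
    refine Tendsto.const_mul _ ?_
    exact (tendsto_add_atTop_iff_nat (f := fun n : ℕ => ((n : ℝ) ^ 4 * r ^ n)) 1).2
      (tendsto_pow_const_mul_const_pow_of_abs_lt_one 4 (by rwa [abs_of_pos hr0]))
  rw [mul_zero] at t1 t3
  obtain ⟨n, h1, h2, h3⟩ := ((t1.eventually_lt_const one_pos).and
    ((t2.eventually_lt_const (by norm_num : (0:ℝ) < 1 / 16)).and (t3.eventually_lt_const hδ))).exists
  set N := ⌈(2 * n + 6) / T⌉₊ with hN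
  have N1 : 2 * n + 6 ≤ N * T := by
    have := Nat.le_ceil ((2 * n + 6) / T)
    rwa [div_le_iff₀ hT] at this
  have N2 : N * T ≤ 2 * n + 6 + T := by
    have := (Nat.ceil_lt_add_one (by positivity : 0 ≤ (2 * n + 6) / T)).le
    rw [← hN] at this
    have := mul_le_mul_of_nonneg_right this hT.le
    rw [add_mul, div_mul_cancel₀ _ hT.ne'] at this
    linarith
  have L1 : m * (N * T) ≤ A * (n + 1) := by
    rw [hA, mul_assoc]
    refine mul_le_mul_of_nonneg_left ?_ (by positivity)
    have : 0 ≤ T * n := by positivity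
    have : (0:ℝ) ≤ n := by positivity
    nlinarith
  set p := ⌊D * (m * (N * T)) ^ 2⌋₊ + 1 with hp
  have p1 : D * (m * (N * T)) ^ 2 < p := by rw [hp]; push_cast; exact Nat.lt_floor_add_one _
  have p2 : (p : ℝ) + 1 ≤ P * (n + 1) ^ 2 := by
    have e1 : (p : ℝ) ≤ D * (m * (N * T)) ^ 2 + 1 := by
      rw [hp]; push_cast
      linarith [Nat.floor_le (by positivity : 0 ≤ D * (m * (N * T)) ^ 2)]
    have e2 : D * (m * (N * T)) ^ 2 ≤ D * (A * (n + 1)) ^ 2 := by gcongr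
    have e3 : (1:ℝ) ≤ (n + 1) ^ 2 := by nlinarith [(by positivity : (0:ℝ) ≤ n)]
    rw [hP]
    nlinarith
  refine ⟨n, N, p, k * r ^ n, by positivity, h1.le, by omega, p1, N1, ?_, h2.le, ?_⟩
  · rw [mul_pow, hk, mul_pow, Real.sq_sqrt hK0.le, ← pow_mul, mul_comm n 2, pow_mul, hr, Real.sq_sqrt hρ0.le]
    norm_num
  · refine lt_of_le_of_lt ?_ h3
    calc m * (8 * ((p:ℝ) + 1) ^ 2 * (k * r ^ n)) ≤ m * (8 * (P * (n + 1) ^ 2) ^ 2 * (k * r ^ n)) := by gcongr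
      _ = _ := by rw [pow_succ r n]; push_cast; field_simp

lemma build {V : ℝ → ℝ} {T : ℝ} (hT : 0 < T) (hV : Continuous V) (hper : Function.Periodic V T)
    {ε : ℝ} (m N : ℕ) (hm : 1 ≤ m) (hN : 1 ≤ N) (W : ℕ → ℝ → ℝ) (kW : ∀ k, Continuous (W k))
    (hWV : ∀ k x, |W k x - V x| ≤ ε) :
    ∃ G : ℝ → ℝ, Continuous G ∧ Function.Periodic G (m * (N * T)) ∧ (∀ x, |G x - V x| ≤ ε) ∧
      ∀ k < m, ∀ t, 1 ≤ t → t ≤ N * T - 1 → G (t + k * (N * T)) = W k t := by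
  have hN' : (1:ℝ) ≤ N := by exact_mod_cast hN
  set ℓ := N * T with hℓ
  have hℓ0 : 0 < ℓ := by positivity
  have hε : 0 ≤ ε := (abs_nonneg _).trans (hWV 0 0)
  have perℓ : Function.Periodic V ℓ := hper.nat_mul N
  set τ : ℝ → ℝ := fun t => max 0 (min 1 (min t (ℓ - t))) with hτ
  have kτ : Continuous τ := by fun_prop
  have τ0 : ∀ t, 0 ≤ τ t := fun t => le_max_left _ _
  have τ1 : ∀ t, τ t ≤ 1 := fun t => max_le zero_le_one (min_le_left _ _)
  obtain ⟨H, kH, hH, hHb⟩ := concat_fun (ε := ε) hℓ0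
    (fun j t => τ t * (W (j % (m : ℤ)).toNat t - V t))
    (fun j => (kτ.mul ((kW _).sub hV)).continuousOn)
    (fun j => by simp [hτ, hℓ0.le]) (fun j => by simp [hτ, hℓ0.le])
    (fun j t _ => by
      rw [abs_mul, abs_of_nonneg (τ0 t)]
      calc τ t * _ ≤ 1 * ε := mul_le_mul (τ1 t) (hWV _ _) (abs_nonneg _) zero_le_one
        _ = ε := one_mul _)
  have hm0 : (m : ℤ) ≠ 0 := by omega
  refine ⟨fun x => V x + H x, hV.add kH, ?_, fun x => by simpa using hHb x, ?_⟩
  · intro x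
    have e1 : V (x + m * ℓ) = V x := perℓ.nat_mul m x
    have e2 : H (x + m * ℓ) = H x := by
      obtain ⟨j, t, ht0, ht1, rfl⟩ := rep hℓ0 x
      have a1 := hH j t ⟨ht0, ht1.le⟩
      have a2 := hH (j + m) t ⟨ht0, ht1.le⟩
      have : ((j : ℝ) * ℓ + t + m * ℓ) = ((j + m : ℤ) : ℝ) * ℓ + t := by push_cast; ring
      rw [this, a2, a1]
      simp
    simp only [e1, e2]
  · intro k hk t h1 h2
    have e1 : V (t + k * ℓ) = V t := perℓ.nat_mul k t
    have e2 := hH k t ⟨by linarith, by linarith⟩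
    have e3 : ((k : ℤ) % (m : ℤ)).toNat = k := by
      rw [Int.emod_eq_of_lt (by omega) (by omega)]; simp
    have e4 : τ t = 1 := by
      simp only [hτ]
      rw [min_eq_left (le_min h1 (by linarith)), max_eq_right zero_le_one]
    have e5 : t + k * ℓ = ((k : ℤ) : ℝ) * ℓ + t := by push_cast; ring
    rw [e3, e4] at e2
    beta_reduce
    rw [e1, e5, e2]; ring


lemma density_periodic {V : ℝ → ℝ} {T : ℝ} (hT : 0 < T) (hV : Continuous V) (hper : Function.Periodic V T)
    {B : ℝ} (hB : ∀ x, |V x| ≤ B) {ε : ℝ} (hε : 0 < ε) {R δ Λ : ℝ} (hR : 0 < R) (hδ : 0 < δ) (hΛ : 1 < Λ) :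
    ∃ (G : ℝ → ℝ) (L : ℝ), Continuous G ∧ 0 < L ∧ Function.Periodic G L ∧ (∀ x, |G x - V x| ≤ ε) ∧
      ∀ lam ∈ Icc Λ⁻¹ Λ, volume (schrodingerSpectrum (fun x => lam * G x) ∩ Icc (-R) R) < ENNReal.ofReal δ := by
  have hΛ0 : 0 < Λ := by linarith
  have hB0 : 0 ≤ B := (abs_nonneg _).trans (hB 0)
  obtain ⟨l, c, hc, hl, hcov⟩ := finite_cover hT hV hper hB hε R Λ hΛ0
  set m := l.length with hm
  have hm1 : 1 ≤ m := by
    obtain ⟨W, hW, -⟩ := hcov (Λ, 0) ⟨⟨(inv_lt_one_of_one_lt₀ hΛ).le.trans hΛ.le, le_rfl⟩, by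
      constructor <;> simp [hR.le]⟩
    exact List.length_pos_of_mem hW
  set W : ℕ → ℝ → ℝ := fun k => l.getD k V with hW
  have hWl : ∀ k, Continuous (W k) ∧ ∀ x, |W k x - V x| ≤ ε := by
    intro k
    by_cases hk : k < l.length
    · have : W k = l[k] := by simp [hW, hk]
      rw [this]; exact hl _ (List.getElem_mem hk)
    · have : W k = V := by
        simp only [hW]; exact List.getD_eq_default _ _ (by omega)
      rw [this]; exact ⟨hV, fun x => by simp [hε.le]⟩
  have hWcov : ∀ lam ∈ Icc Λ⁻¹ Λ, ∀ E ∈ Icc (-R) R, ∃ k < m, Res (Ioi 0) (fun x => lam * W k x - E) c := by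
    intro lam hlam E hE
    obtain ⟨W', hW', hr⟩ := hcov (lam, E) ⟨hlam, hE⟩
    obtain ⟨k, hk, rfl⟩ := List.mem_iff_getElem.1 hW'
    refine ⟨k, hk, ?_⟩
    have : W k = l[k] := by simp [hW, hk]
    rw [this]; exact hr
  set B' := Λ * (B + ε) with hB'
  have hB'0 : 0 ≤ B' := by positivity
  obtain ⟨K, hK1, hcell⟩ := cell_res (B' + R) (by positivity)
  set D := 1 / 2 + B' + 4 * (1 + R ^ 2) with hD
  obtain ⟨n, N, p, η, hη, hη1, hp, hpD, hnN, hρ1, hρ2, hfin⟩ :=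
    consts (D := D) hT hK1 hc (by positivity) hδ m
  have hN1 : 1 ≤ N := by
    by_contra hN0
    have : N = 0 := by omega
    rw [this] at hnN
    have : (0:ℝ) ≤ n := by positivity
    norm_num at hnN; linarith
  obtain ⟨G, kG, perG, hGV, hGW⟩ := build hT hV hper m N hm1 hN1 W (fun k => (hWl k).1) (fun k => (hWl k).2)
  set ℓ := N * T with hℓ
  set L := m * ℓ with hL
  have hn0 : (0:ℝ) ≤ n := by positivity
  have hℓ0 : 0 < ℓ := by linarith
  have hm1' : (1:ℝ) ≤ m := by exact_mod_cast hm1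
  have hLℓ : ℓ ≤ L := by rw [hL]; nlinarith
  have hL0 : 0 < L := by linarith
  refine ⟨G, L, kG, hL0, perG, hGV, ?_⟩
  intro lam hlam
  have hl0 : 0 < lam := lt_of_lt_of_le (inv_pos.2 hΛ0) hlam.1
  have hGB : ∀ x, |lam * G x| ≤ B' := by
    intro x
    have e : G x = V x + (G x - V x) := by ring
    have : |G x| ≤ B + ε := by
      rw [e]; exact (abs_add_le _ _).trans (add_le_add (hB x) (hGV x))
    rw [abs_mul, abs_of_pos hl0, hB']
    exact mul_le_mul hlam.2 this (abs_nonneg _) hΛ0.le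
  have hp' : (1:ℝ) ≤ p := by exact_mod_cast hp
  have hpL : L ^ 2 * (1 / 2 + B' + 2 * (p + 1) * (1 + R ^ 2)) < p ^ 2 := by
    have e1 : 1 / 2 + B' + 2 * (p + 1) * (1 + R ^ 2) ≤ D * p := by
      have : 0 ≤ (1 / 2 + B' + 2 * (1 + R ^ 2)) * ((p:ℝ) - 1) :=
        mul_nonneg (by positivity) (by linarith)
      rw [hD]; linarith
    calc L ^ 2 * (1 / 2 + B' + 2 * (p + 1) * (1 + R ^ 2)) ≤ L ^ 2 * (D * p) := by gcongr
      _ = (D * L ^ 2) * p := by ring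
      _ < p * p := by gcongr
      _ = _ := by ring
  set a : ℕ → ℝ := fun k => k * ℓ + ℓ / 2 with ha
  set Z : ℕ → Set ℝ := fun k => {E | E ∈ Icc (-R) R ∧
    ¬ Res (Ioo (a k) (a k + L)) (fun x => lam * G x - E) (η ^ 2)} with hZ
  have hsub : schrodingerSpectrum (fun x => lam * G x) ∩ Icc (-R) R ⊆ ⋃ k ∈ Finset.range m, Z k := by
    rintro E ⟨hEs, hE⟩
    obtain ⟨k, hk, hr⟩ := hWcov lam hlam E hE
    refine mem_biUnion (Finset.mem_coe.2 (Finset.mem_range.2 hk)) ⟨hE, fun hres => ?_⟩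
    have hq : Continuous (fun x => lam * G x - E) := by fun_prop
    have r1 : Res (Ioo (ℓ / 2 - (n + 2)) (ℓ / 2 + (n + 2))) (fun x => lam * W k x - E) c :=
      hr.mono fun x hx => lt_of_le_of_lt (by linarith) hx.1
    have r2 : Res (Ioo (a k - (n + 2)) (a k + (n + 2))) (fun x => lam * G x - E) c := by
      refine r1.translate (d := k * ℓ) ?_ ?_
      · rintro x ⟨h1, h2⟩
        simp only [ha] at h1 h2
        exact ⟨by linarith, by linarith⟩
      · rintro x ⟨h1, h2⟩
        beta_reduce
        rw [hGW k hk x (by linarith) (by linarith)]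
    obtain ⟨c', hc', hres'⟩ := hcell (fun x => lam * G x - E) hq (fun x => by
        refine (abs_sub _ _).trans (add_le_add (hGB x) (abs_le.2 hE)))
      L (fun x => by simp only [perG x]) (a k) n c η hc hη (by linarith) r2 hres hρ1 hρ2
    exact not_mem_spec_of_res (by fun_prop) hc' hres' hEs
  have hZm : ∀ k, volume (Z k) ≤ ENNReal.ofReal (8 * (p + 1) ^ 2 * η) := fun k =>
    counting (Q := fun x => lam * G x) (by fun_prop) hGB hL0 hη hη1 hp hpL
  calc volume (schrodingerSpectrum (fun x => lam * G x) ∩ Icc (-R) R)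
      ≤ volume (⋃ k ∈ Finset.range m, Z k) := measure_mono hsub
    _ ≤ ∑ k ∈ Finset.range m, volume (Z k) := measure_biUnion_finset_le _ _
    _ ≤ ∑ k ∈ Finset.range m, ENNReal.ofReal (8 * (p + 1) ^ 2 * η) := Finset.sum_le_sum fun k _ => hZm k
    _ = ENNReal.ofReal (m * (8 * (p + 1) ^ 2 * η)) := by
      rw [Finset.sum_const, Finset.card_range, nsmul_eq_mul, ENNReal.ofReal_mul (p := (m:ℝ)) (by positivity),
        ENNReal.ofReal_natCast]
    _ < ENNReal.ofReal δ := (ENNReal.ofReal_lt_ofReal_iff hδ).2 hfin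

lemma Uset_dense (R δ Λ : ℝ) (hR : 0 < R) (hδ : 0 < δ) (hΛ : 1 < Λ) : Dense (Uset R δ Λ) := by
  rw [Metric.dense_iff]
  rintro ⟨V0, hV0⟩ r hr
  obtain ⟨V, ⟨T, hT, hper⟩, hd⟩ := Metric.mem_closure_iff.1 hV0 (r / 2) (by linarith)
  obtain ⟨G, L, kG, hL, perG, hGV, hG⟩ := density_periodic hT V.continuous hper (B := ‖V‖)
    (fun x => V.norm_coe_le_norm x) (ε := r / 3) (by linarith) hR hδ hΛ
  set g : ℝ →ᵇ ℝ := BoundedContinuousFunction.ofNormedAddCommGroup G kG (‖V‖ + r / 3) (fun x => by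
    have e : G x = V x + (G x - V x) := by ring
    rw [e]
    exact (abs_add_le _ _).trans (add_le_add (V.norm_coe_le_norm x) (hGV x))) with hg
  have hgLP : g ∈ LP := subset_closure ⟨L, hL, perG⟩
  refine ⟨⟨g, hgLP⟩, ?_, hG⟩
  rw [Metric.mem_ball, Subtype.dist_eq]
  have : dist g V ≤ r / 3 := (BoundedContinuousFunction.dist_le (by linarith)).2 fun x => by
    rw [Real.dist_eq]; exact hGV x
  calc dist g V0 ≤ dist g V + dist V V0 := dist_triangle _ _ _
    _ < r := by rw [dist_comm V V0]; linarith

/-- For all `R, δ > 0` and `Λ > 1`, the set `U_{R,δ,Λ}` is a dense open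
subset of `LP`. -/
theorem Uset_isOpen_dense (R δ Λ : ℝ) (hR : 0 < R) (hδ : 0 < δ) (hΛ : 1 < Λ) :
    IsOpen (Uset R δ Λ) ∧ Dense (Uset R δ Λ) := by
  exact ⟨Uset_open R δ Λ, Uset_dense R δ Λ hR hδ hΛ⟩
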